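/- arXiv:2005.03335 — 2 statements merged into one kernel-verified Lean document; each statement's English description precedes it below -/
import Mathlib

section
/- If T is a subcubic tree of order n with dissociation number ψ, then the number of maximum dissociation sets of T is at most 1.466^(4n - 5ψ + 2). -/
/-- `F` is a dissociation set of `G`: the induced subgraph `G[F]` has maximum degree at most 1. -/
def IsDissocSet {V : Type*} (G : SimpleGraph V) (F : Finset V) : Prop :=
  ∀ v ∈ F, ∀ u ∈ F, ∀ w ∈ F, G.Adj v u → G.Adj v w → u = w

/-- The dissociation number of `G`. -/
noncomputable def dissocNum {V : Type*} [Fintype V] (G : SimpleGraph V) : ℕ :=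
  sSup {n | ∃ F : Finset V, IsDissocSet G F ∧ F.card = n}

/-- `F` is a maximum dissociation set of `G`. -/
def IsMaxDissocSet {V : Type*} [Fintype V] (G : SimpleGraph V) (F : Finset V) : Prop :=
  IsDissocSet G F ∧ F.card = dissocNum G

/-- The number of maximum dissociation sets of `G`. -/
noncomputable def numMaxDissoc {V : Type*} [Fintype V] (G : SimpleGraph V) : ℕ :=
  {F : Finset V | IsMaxDissocSet G F}.ncard

/-- `G` is subcubic: every vertex has degree at most 3. -/
def Subcubic {V : Type*} (G : SimpleGraph V) : Prop :=
  ∀ v : V, (G.neighborSet v).ncard ≤ 3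

structure NP (s a b : ℝ) : Prop where
  hs : 0 ≤ s
  ha : 0 ≤ a
  hb : 0 ≤ b
  g1 : 4 * s + 1 * b ≤ 5
  g2 : 1 * b ≤ 1
  g3 : 11 * s + 14 * a + 15 * b ≤ 40
structure NQ (s a b : ℝ) : Prop where
  hs : 0 ≤ s
  ha : 0 ≤ a
  hb : 0 ≤ b
  g1 : 4 * s + 3 * a + 3 * b ≤ 10
  g2 : 7 * s + 5 * a ≤ 12
  g3 : 1 * s ≤ 1
structure NR (s a : ℝ) : Prop where
  hs : 0 ≤ s
  ha : 0 ≤ a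
  g1 : 3 * s + 1 * a ≤ 5
  g2 : 233 * s + 267 * a ≤ 500
  g3 : 1 * a ≤ 1
structure NZ (s a b : ℝ) : Prop where
  hs : 0 ≤ s
  ha : 0 ≤ a
  hb : 0 ≤ b
  g1 : 108 * s + 125 * a + 51 * b ≤ 500
  g2 : 4 * a + 3 * b ≤ 8
  g3 : 3 * s + 1 * a ≤ 10
theorem auxRR {s1 a1 s2 a2 : ℝ} (hs1 : 0 ≤ s1) (ha1 : 0 ≤ a1) (g11 : 3 * s1 + a1 ≤ 5) (g21 : 233 * s1 + 267 * a1 ≤ 500) (g31 : a1 ≤ 1)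
  (hs2 : 0 ≤ s2) (ha2 : 0 ≤ a2) (g12 : 3 * s2 + a2 ≤ 5) (g22 : 233 * s2 + 267 * a2 ≤ 500) (g32 : a2 ≤ 1) :
  11 * (a1*a2) + 14 * (s1*s2) + 15 * (a1*a2) ≤ 40 := by
  have key : ∀ s a : ℝ, 0 ≤ s → 0 ≤ a → 3 * s + a ≤ 5 → 233 * s + 267 * a ≤ 500 → a ≤ 1 → 14 * s^2 + 26 * a^2 ≤ 40 := by
    intro s a hs ha g1 g2 g3
    nlinarith [mul_nonneg hs (sub_nonneg.2 g1), mul_nonneg hs (sub_nonneg.2 g2), mul_nonneg ha (sub_nonneg.2 g2), mul_nonneg ha (sub_nonneg.2 g3), mul_nonneg ha (sub_nonneg.2 g1), mul_nonneg (sub_nonneg.2 g1) (sub_nonneg.2 g2), mul_nonneg (sub_nonneg.2 g1) (sub_nonneg.2 g3), mul_nonneg (sub_nonneg.2 g2) (sub_nonneg.2 g3), mul_nonneg hs (sub_nonneg.2 g3)]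
  nlinarith [key s1 a1 hs1 ha1 g11 g21 g31, key s2 a2 hs2 ha2 g12 g22 g32, sq_nonneg (s1-s2), sq_nonneg (a1-a2)]
theorem auxPP {s1 a1 b1 s2 a2 b2 : ℝ} (hs1 : 0 ≤ s1) (ha1 : 0 ≤ a1) (hb1 : 0 ≤ b1) (g11 : 4 * s1 + b1 ≤ 5) (g21 : b1 ≤ 1) (g31 : 11 * s1 + 14 * a1 + 15 * b1 ≤ 40)
  (hs2 : 0 ≤ s2) (ha2 : 0 ≤ a2) (hb2 : 0 ≤ b2) (g12 : 4 * s2 + b2 ≤ 5) (g22 : b2 ≤ 1) (g32 : 11 * s2 + 14 * a2 + 15 * b2 ≤ 40) :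
  3 * ((500/733 : ℝ)^2 * (s1*s2+(b1*a2+a1*b2))) + 1 * ((500/733 : ℝ)^2 * (s1*s2)) ≤ 5 := by
  suffices 4 * s1 * s2 + 3 * b1 * a2 + 3 * a1 * b2 ≤ 10.745 by nlinarith
  have A := mul_nonneg hb1 (sub_nonneg.2 g32)
  rcases le_total (56 * s1) (33 * b1) with h | h
  · have B := mul_nonneg (sub_nonneg.2 h) hs2
    rcases le_total (14 * a1) (15 * b1) with h' | h'
    · have C := mul_nonneg (sub_nonneg.2 h') hb2
      linarith
    · have C := mul_nonneg (sub_nonneg.2 h') (sub_nonneg.2 g22)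
      linarith
  · have B := mul_nonneg (sub_nonneg.2 h) (sub_nonneg.2 g12)
    rcases le_total (3 * a1) ((56 * s1 - 33 * b1)/56 + 45 * b1 / 14) with h' | h'
    · have C := mul_nonneg (sub_nonneg.2 h') hb2
      linarith
    · have C := mul_nonneg (sub_nonneg.2 h') (sub_nonneg.2 g22)
      linarith
theorem auxRZ {s1 a1 s2 a2 b2: ℝ} (hs1 : 0 ≤ s1) (ha1 : 0 ≤ a1) (g11 : 3 * s1 + a1 ≤ 5) (g21 : 233 * s1 + 267 * a1 ≤ 500) (g31 : a1 ≤ 1)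
 (hs2 : 0 ≤ s2) (ha2 : 0 ≤ a2) (hb2 : 0 ≤ b2) (g12 : 108 * s2 + 125 * a2 + 51 * b2 ≤ 500) (g22 : 4 * a2 + 3 * b2 ≤ 8) (g32 : 3 * s2 + a2 ≤ 10) :
  11 * ((500/733 : ℝ)^2 * (a1*a2+a1*b2)) + 14 * ((500/733 : ℝ)^2 * (s1*s2)) + 15 * ((500/733 : ℝ)^2 * (a1*a2)) ≤ 40 := by
  suffices 14 * s2 * s1 + (26 * a2 + 11 * b2) * a1 ≤ 85.96 by nlinarith
  set c := 26 * a2 + 11 * b2 with hc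
  rcases le_total (3 * c) (14 * s2) with h | h
  · have B := mul_nonneg (sub_nonneg.2 h) ha1
    have A := mul_nonneg hs2 (sub_nonneg.2 g11)
    linarith
  · rcases le_total (233 * c) (267 * 14 * s2) with h' | h'
    · have B := mul_nonneg (sub_nonneg.2 h) (sub_nonneg.2 g21)
      have A := mul_nonneg (sub_nonneg.2 h') (sub_nonneg.2 g11)
      linarith
    · have B := mul_nonneg hs2 (sub_nonneg.2 g21)
      have A := mul_nonneg (sub_nonneg.2 h') (sub_nonneg.2 g31)
      linarith
theorem auxZZ {s1 a1 b1 s2 a2 b2: ℝ} 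
 (hs1 : 0 ≤ s1) (ha1 : 0 ≤ a1) (hb1 : 0 ≤ b1) (g11 : 108 * s1 + 125 * a1 + 51 * b1 ≤ 500) (g21 : 4 * a1 + 3 * b1 ≤ 8) (g31 : 3 * s1 + a1 ≤ 10) 
 (hs2 : 0 ≤ s2) (ha2 : 0 ≤ a2) (hb2 : 0 ≤ b2) (g12 : 108 * s2 + 125 * a2 + 51 * b2 ≤ 500) (g22 : 4 * a2 + 3 * b2 ≤ 8) (g32 : 3 * s2 + a2 ≤ 10) :
  11 * ((500/733 : ℝ)^4 * (a1*a2+(a1*b2+b1*a2))) + 14 * ((500/733 : ℝ)^4 * (s1*s2)) + 15 * ((500/733 : ℝ)^4 * (a1*a2)) ≤ 40 := by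
  suffices 14 * s1 * s2 + (26 * a1 + 11 * b1) * a2 + 11 * a1 * b2 ≤ 184.7 by nlinarith
  obtain ⟨c, hc⟩ : ∃ c, c = 26 * a1 + 11 * b1 := ⟨_, rfl⟩
  rw [← hc]
  rcases le_total (3 * c) (44 * a1 + 14 * s1) with h | h
  · have A := mul_nonneg (sub_nonneg.2 h) ha2
    have B := mul_nonneg hs1 (sub_nonneg.2 g32)
    have C := mul_nonneg ha1 (sub_nonneg.2 g22)
    linarith
  · rcases le_total (125 * 14 * s1) (108 * c) with h' | h'
    · have B := mul_nonneg hs1 (sub_nonneg.2 g12)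
      have C := mul_nonneg (sub_nonneg.2 h') (sub_nonneg.2 g22)
      rcases le_total (11 * a1) (51 * (14 * s1 / 108) + 3 * (c - 125 * (14 * s1 / 108))/4) with h2 | h2
      · have D := mul_nonneg (sub_nonneg.2 h2) hb2
        linarith
      · have D := mul_nonneg (sub_nonneg.2 h2) (sub_nonneg.2 g22)
        have E := mul_nonneg (sub_nonneg.2 h2) ha2
        linarith
    · have B := mul_nonneg (sub_nonneg.2 h) (sub_nonneg.2 g12)
      have B' := mul_nonneg ha1 (sub_nonneg.2 g12)
      have C := mul_nonneg (sub_nonneg.2 h') (sub_nonneg.2 g32)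
      rcases le_total (11 * a1) (51 * (3 * c - 14 * s1) / 267) with h2 | h2
      · have D := mul_nonneg (sub_nonneg.2 h2) hb2
        linarith
      · have D := mul_nonneg (sub_nonneg.2 h2) (sub_nonneg.2 g22)
        have E := mul_nonneg (sub_nonneg.2 h2) ha2
        linarith
theorem cPP {s1 a1 b1 s2 a2 b2 : ℝ} (h : NP s1 a1 b1) (k : NP s2 a2 b2) :
    NR ((500/733 : ℝ)^2 * (s1*s2+(b1*a2+a1*b2))) ((500/733 : ℝ)^2 * (s1*s2)) := by
  obtain ⟨hs1, ha1, hb1, g11, g21, g31⟩ := h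
  obtain ⟨hs2, ha2, hb2, g12, g22, g32⟩ := k
  refine ⟨by positivity, by positivity, ?_, ?_, ?_⟩
  · linarith [auxPP hs1 ha1 hb1 (by linarith) (by linarith) (by linarith) hs2 ha2 hb2 (by linarith) (by linarith) (by linarith)]
  · linarith [mul_nonneg hs1 (sub_nonneg.2 g12), mul_nonneg ha1 (sub_nonneg.2 g12), mul_nonneg ha1 (sub_nonneg.2 g22), mul_nonneg ha1 (sub_nonneg.2 g32), mul_nonneg hb1 (sub_nonneg.2 g32), mul_nonneg (sub_nonneg.2 g11) hs2, mul_nonneg (sub_nonneg.2 g11) ha2, mul_nonneg (sub_nonneg.2 g11) (sub_nonneg.2 g22), mul_nonneg (sub_nonneg.2 g11) (sub_nonneg.2 g32), mul_nonneg (sub_nonneg.2 g21) ha2, mul_nonneg (sub_nonneg.2 g21) (sub_nonneg.2 g12), mul_nonneg (sub_nonneg.2 g21) (sub_nonneg.2 g22), mul_nonneg (sub_nonneg.2 g31) ha2, mul_nonneg (sub_nonneg.2 g31) hb2, mul_nonneg (sub_nonneg.2 g31) (sub_nonneg.2 g32), mul_nonneg hs1 hs2, mul_nonneg hs1 ha2,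 mul_nonneg hs1 hb2, mul_nonneg ha1 hs2, mul_nonneg ha1 ha2, mul_nonneg ha1 hb2, mul_nonneg hb1 hs2, mul_nonneg hb1 ha2, mul_nonneg hb1 hb2]
  · linarith [mul_nonneg hs1 (sub_nonneg.2 g12), mul_nonneg ha1 (sub_nonneg.2 g12), mul_nonneg ha1 (sub_nonneg.2 g32), mul_nonneg hb1 (sub_nonneg.2 g32), mul_nonneg (sub_nonneg.2 g11) hs2, mul_nonneg (sub_nonneg.2 g31) ha2, mul_nonneg (sub_nonneg.2 g31) hb2, mul_nonneg (sub_nonneg.2 g31) (sub_nonneg.2 g12), mul_nonneg (sub_nonneg.2 g31) (sub_nonneg.2 g32), mul_nonneg hs1 hs2, mul_nonneg hs1 ha2, mul_nonneg hs1 hb2, mul_nonneg ha1 hs2, mul_nonneg ha1 ha2, mul_nonneg ha1 hb2, mul_nonneg hb1 hs2, mul_nonneg hb1 ha2, mul_nonneg hb1 hb2]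
theorem cPQ {s1 a1 b1 s2 a2 b2 : ℝ} (h : NP s1 a1 b1) (k : NQ s2 a2 b2) :
    NR ((500/733 : ℝ) * (s1*s2+b1*a2)) ((500/733 : ℝ) * (s1*s2)) := by
  obtain ⟨hs1, ha1, hb1, g11, g21, g31⟩ := h
  obtain ⟨hs2, ha2, hb2, g12, g22, g32⟩ := k
  refine ⟨by positivity, by positivity, ?_, ?_, ?_⟩
  · linarith [g22, mul_nonneg hs1 (sub_nonneg.2 g22), mul_nonneg ha1 (sub_nonneg.2 g32), mul_nonneg hb1 (sub_nonneg.2 g22), mul_nonneg (sub_nonneg.2 g11) hs2, mul_nonneg (sub_nonneg.2 g21) ha2, mul_nonneg (sub_nonneg.2 g21) (sub_nonneg.2 g32), mul_nonneg (sub_nonneg.2 g31) (sub_nonneg.2 g32), mul_nonneg hs1 hs2, mul_nonneg hs1 ha2, mul_nonneg hs1 hb2, mul_nonneg ha1 hs2, mul_nonneg ha1 ha2, mul_nonneg ha1 hb2, mul_nonneg hb1 hs2, mul_nonneg hb1 ha2, mul_nonneg hb1 hb2]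
  · linarith [g22, mul_nonneg hs1 (sub_nonneg.2 g32), mul_nonneg ha1 (sub_nonneg.2 g32), mul_nonneg hb1 (sub_nonneg.2 g22), mul_nonneg (sub_nonneg.2 g11) hs2, mul_nonneg (sub_nonneg.2 g21) ha2, mul_nonneg (sub_nonneg.2 g21) (sub_nonneg.2 g32), mul_nonneg (sub_nonneg.2 g31) (sub_nonneg.2 g32), mul_nonneg hs1 hs2, mul_nonneg hs1 ha2, mul_nonneg hs1 hb2, mul_nonneg ha1 hs2, mul_nonneg ha1 ha2, mul_nonneg ha1 hb2, mul_nonneg hb1 hs2, mul_nonneg hb1 ha2, mul_nonneg hb1 hb2]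
  · linarith [g22, mul_nonneg hs1 (sub_nonneg.2 g22), mul_nonneg ha1 (sub_nonneg.2 g32), mul_nonneg hb1 (sub_nonneg.2 g22), mul_nonneg (sub_nonneg.2 g11) hs2, mul_nonneg (sub_nonneg.2 g31) (sub_nonneg.2 g32), mul_nonneg hs1 hs2, mul_nonneg hs1 ha2, mul_nonneg hs1 hb2, mul_nonneg ha1 hs2, mul_nonneg ha1 ha2, mul_nonneg ha1 hb2, mul_nonneg hb1 hs2, mul_nonneg hb1 ha2, mul_nonneg hb1 hb2]
theorem cQQ {s1 a1 b1 s2 a2 b2 : ℝ} (h : NQ s1 a1 b1) (k : NQ s2 a2 b2) :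
    NR ((s1*s2)) ((s1*s2)) := by
  obtain ⟨hs1, ha1, hb1, g11, g21, g31⟩ := h
  obtain ⟨hs2, ha2, hb2, g12, g22, g32⟩ := k
  refine ⟨by positivity, by positivity, ?_, ?_, ?_⟩
  · linarith [g22, mul_nonneg hs1 (sub_nonneg.2 g32), mul_nonneg ha1 (sub_nonneg.2 g22), mul_nonneg (sub_nonneg.2 g21) ha2, mul_nonneg (sub_nonneg.2 g21) (sub_nonneg.2 g22), mul_nonneg (sub_nonneg.2 g31) hs2, mul_nonneg hs1 hs2, mul_nonneg hs1 ha2, mul_nonneg hs1 hb2, mul_nonneg ha1 hs2, mul_nonneg ha1 ha2, mul_nonneg ha1 hb2, mul_nonneg hb1 hs2, mul_nonneg hb1 ha2, mul_nonneg hb1 hb2]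
  · linarith [g32, mul_nonneg (sub_nonneg.2 g31) hs2, mul_nonneg hs1 hs2, mul_nonneg hs1 ha2, mul_nonneg hs1 hb2, mul_nonneg ha1 hs2, mul_nonneg ha1 ha2, mul_nonneg ha1 hb2, mul_nonneg hb1 hs2, mul_nonneg hb1 ha2, mul_nonneg hb1 hb2]
  · linarith [g32, mul_nonneg (sub_nonneg.2 g31) hs2, mul_nonneg hs1 hs2, mul_nonneg hs1 ha2, mul_nonneg hs1 hb2, mul_nonneg ha1 hs2, mul_nonneg ha1 ha2, mul_nonneg ha1 hb2, mul_nonneg hb1 hs2, mul_nonneg hb1 ha2, mul_nonneg hb1 hb2]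
theorem cQR {s1 a1 b1 s2 a2 : ℝ} (h : NQ s1 a1 b1) (k : NR s2 a2) :
    NZ ((s1*s2+a1*a2+b1*a2)) ((s1*s2)) ((a1*a2)) := by
  obtain ⟨hs1, ha1, hb1, g11, g21, g31⟩ := h
  obtain ⟨hs2, ha2, g12, g22, g32⟩ := k
  refine ⟨by positivity, by positivity, by positivity, ?_, ?_, ?_⟩
  · linarith [mul_nonneg hs1 (sub_nonneg.2 g22), mul_nonneg ha1 (sub_nonneg.2 g22), mul_nonneg (sub_nonneg.2 g11) ha2, mul_nonneg (sub_nonneg.2 g21) hs2, mul_nonneg (sub_nonneg.2 g21) ha2, mul_nonneg (sub_nonneg.2 g21) (sub_nonneg.2 g12), mul_nonneg (sub_nonneg.2 g31) hs2, mul_nonneg (sub_nonneg.2 g31) (sub_nonneg.2 g32), mul_nonneg hs1 hs2, mul_nonneg hs1 ha2, mul_nonneg ha1 hs2, mul_nonneg ha1 ha2, mul_nonneg hb1 hs2, mul_nonneg hb1 ha2]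
  · linarith [g22, mul_nonneg hs1 (sub_nonneg.2 g12), mul_nonneg hs1 (sub_nonneg.2 g22), mul_nonneg ha1 (sub_nonneg.2 g32), mul_nonneg (sub_nonneg.2 g21) hs2, mul_nonneg (sub_nonneg.2 g21) ha2, mul_nonneg (sub_nonneg.2 g21) (sub_nonneg.2 g12), mul_nonneg (sub_nonneg.2 g31) hs2, mul_nonneg (sub_nonneg.2 g31) (sub_nonneg.2 g32), mul_nonneg hs1 hs2, mul_nonneg hs1 ha2, mul_nonneg ha1 hs2, mul_nonneg ha1 ha2, mul_nonneg hb1 hs2, mul_nonneg hb1 ha2]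
  · linarith [mul_nonneg hs1 (sub_nonneg.2 g22), mul_nonneg ha1 (sub_nonneg.2 g32), mul_nonneg (sub_nonneg.2 g11) ha2, mul_nonneg (sub_nonneg.2 g21) (sub_nonneg.2 g32), mul_nonneg (sub_nonneg.2 g31) (sub_nonneg.2 g32), mul_nonneg hs1 hs2, mul_nonneg hs1 ha2, mul_nonneg ha1 hs2, mul_nonneg ha1 ha2, mul_nonneg hb1 hs2, mul_nonneg hb1 ha2]
theorem cQZ {s1 a1 b1 s2 a2 b2 : ℝ} (h : NQ s1 a1 b1) (k : NZ s2 a2 b2) :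
    NZ ((500/733 : ℝ)^2 * (s1*s2+a1*a2+(b1*a2+a1*b2))) ((500/733 : ℝ)^2 * (s1*s2)) ((500/733 : ℝ)^2 * (a1*a2)) := by
  obtain ⟨hs1, ha1, hb1, g11, g21, g31⟩ := h
  obtain ⟨hs2, ha2, hb2, g12, g22, g32⟩ := k
  refine ⟨by positivity, by positivity, by positivity, ?_, ?_, ?_⟩
  · linarith [mul_nonneg hs1 (sub_nonneg.2 g12), mul_nonneg hs1 (sub_nonneg.2 g32), mul_nonneg ha1 (sub_nonneg.2 g12), mul_nonneg ha1 (sub_nonneg.2 g22), mul_nonneg (sub_nonneg.2 g11) ha2, mul_nonneg (sub_nonneg.2 g21) hs2, mul_nonneg (sub_nonneg.2 g21) ha2, mul_nonneg (sub_nonneg.2 g21) hb2, mul_nonneg (sub_nonneg.2 g21) (sub_nonneg.2 g32), mul_nonneg (sub_nonneg.2 g31) hs2, mul_nonneg (sub_nonneg.2 g31) hb2, mul_nonneg (sub_nonneg.2 g31) (sub_nonneg.2 g22), mul_nonneg hs1 hs2, mul_nonneg hs1 ha2, mul_nonneg hs1 hb2, mul_nonneg ha1 hs2, mul_nonneg ha1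 ha2, mul_nonneg ha1 hb2, mul_nonneg hb1 hs2, mul_nonneg hb1 ha2, mul_nonneg hb1 hb2]
  · linarith [mul_nonneg hs1 (sub_nonneg.2 g32), mul_nonneg ha1 (sub_nonneg.2 g12), mul_nonneg ha1 (sub_nonneg.2 g22), mul_nonneg (sub_nonneg.2 g21) hs2, mul_nonneg (sub_nonneg.2 g21) ha2, mul_nonneg (sub_nonneg.2 g21) (sub_nonneg.2 g32), mul_nonneg (sub_nonneg.2 g31) hs2, mul_nonneg (sub_nonneg.2 g31) hb2, mul_nonneg (sub_nonneg.2 g31) (sub_nonneg.2 g22), mul_nonneg hs1 hs2, mul_nonneg hs1 ha2, mul_nonneg hs1 hb2, mul_nonneg ha1 hs2, mul_nonneg ha1 ha2, mul_nonneg ha1 hb2, mul_nonneg hb1 hs2, mul_nonneg hb1 ha2, mul_nonneg hb1 hb2]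
  · linarith [g12, mul_nonneg hs1 (sub_nonneg.2 g12), mul_nonneg ha1 (sub_nonneg.2 g22), mul_nonneg (sub_nonneg.2 g11) ha2, mul_nonneg (sub_nonneg.2 g21) hb2, mul_nonneg (sub_nonneg.2 g21) (sub_nonneg.2 g22), mul_nonneg (sub_nonneg.2 g31) hs2, mul_nonneg (sub_nonneg.2 g31) hb2, mul_nonneg (sub_nonneg.2 g31) (sub_nonneg.2 g22), mul_nonneg hs1 hs2, mul_nonneg hs1 ha2, mul_nonneg hs1 hb2, mul_nonneg ha1 hs2, mul_nonneg ha1 ha2, mul_nonneg ha1 hb2, mul_nonneg hb1 hs2, mul_nonneg hb1 ha2, mul_nonneg hb1 hb2]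
theorem cPR {s1 a1 b1 s2 a2 : ℝ} (h : NP s1 a1 b1) (k : NR s2 a2) :
    NQ ((b1*a2)) ((s1*s2)) ((a1*a2)) := by
  obtain ⟨hs1, ha1, hb1, g11, g21, g31⟩ := h
  obtain ⟨hs2, ha2, g12, g22, g32⟩ := k
  refine ⟨by positivity, by positivity, by positivity, ?_, ?_, ?_⟩
  · linarith [mul_nonneg hs1 (sub_nonneg.2 g22), mul_nonneg ha1 (sub_nonneg.2 g32), mul_nonneg hb1 (sub_nonneg.2 g22), mul_nonneg hb1 (sub_nonneg.2 g32), mul_nonneg (sub_nonneg.2 g11) hs2, mul_nonneg (sub_nonneg.2 g11) (sub_nonneg.2 g32), mul_nonneg (sub_nonneg.2 g21) ha2, mul_nonneg (sub_nonneg.2 g21) (sub_nonneg.2 g12), mul_nonneg (sub_nonneg.2 g31) hs2, mul_nonneg (sub_nonneg.2 g31) ha2, mul_nonneg (sub_nonneg.2 g31) (sub_nonneg.2 g12), mul_nonneg hs1 hs2, mul_nonneg hs1 ha2, mul_nonneg ha1 hs2, mul_nonneg ha1 ha2, mul_nonneg hb1 hs2, mul_nonneg hb1 ha2]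
  · linarith [g22, mul_nonneg hb1 (sub_nonneg.2 g22), mul_nonneg hb1 (sub_nonneg.2 g32), mul_nonneg (sub_nonneg.2 g11) hs2, mul_nonneg (sub_nonneg.2 g21) ha2, mul_nonneg (sub_nonneg.2 g21) (sub_nonneg.2 g12), mul_nonneg hs1 hs2, mul_nonneg hs1 ha2, mul_nonneg ha1 hs2, mul_nonneg ha1 ha2, mul_nonneg hb1 hs2, mul_nonneg hb1 ha2]
  · linarith [mul_nonneg hb1 (sub_nonneg.2 g32), mul_nonneg (sub_nonneg.2 g21) hs2, mul_nonneg (sub_nonneg.2 g21) ha2, mul_nonneg (sub_nonneg.2 g21) (sub_nonneg.2 g12), mul_nonneg hs1 hs2, mul_nonneg hs1 ha2, mul_nonneg ha1 hs2, mul_nonneg ha1 ha2, mul_nonneg hb1 hs2, mul_nonneg hb1 ha2]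
theorem cPZ {s1 a1 b1 s2 a2 b2 : ℝ} (h : NP s1 a1 b1) (k : NZ s2 a2 b2) :
    NQ ((500/733 : ℝ)^2 * (b1*a2)) ((500/733 : ℝ)^2 * (s1*s2)) ((500/733 : ℝ)^2 * (a1*a2)) := by
  obtain ⟨hs1, ha1, hb1, g11, g21, g31⟩ := h
  obtain ⟨hs2, ha2, hb2, g12, g22, g32⟩ := k
  refine ⟨by positivity, by positivity, by positivity, ?_, ?_, ?_⟩
  · linarith [mul_nonneg hs1 (sub_nonneg.2 g12), mul_nonneg ha1 (sub_nonneg.2 g12), mul_nonneg ha1 (sub_nonneg.2 g22), mul_nonneg hb1 (sub_nonneg.2 g12), mul_nonneg hb1 (sub_nonneg.2 g22), mul_nonneg (sub_nonneg.2 g11) hs2, mul_nonneg (sub_nonneg.2 g11) hb2, mul_nonneg (sub_nonneg.2 g11) (sub_nonneg.2 g22), mul_nonneg (sub_nonneg.2 g21) ha2, mul_nonneg (sub_nonneg.2 g31) hs2, mul_nonneg (sub_nonneg.2 g31) ha2, mul_nonneg (sub_nonneg.2 g31) hb2, mul_nonneg (sub_nonneg.2 g31) (sub_nonneg.2 g32),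 mul_nonneg hs1 hs2, mul_nonneg hs1 ha2, mul_nonneg hs1 hb2, mul_nonneg ha1 hs2, mul_nonneg ha1 ha2, mul_nonneg ha1 hb2, mul_nonneg hb1 hs2, mul_nonneg hb1 ha2, mul_nonneg hb1 hb2]
  · linarith [g12, mul_nonneg hs1 (sub_nonneg.2 g12), mul_nonneg ha1 (sub_nonneg.2 g12), mul_nonneg hb1 (sub_nonneg.2 g12), mul_nonneg hb1 (sub_nonneg.2 g22), mul_nonneg (sub_nonneg.2 g11) hs2, mul_nonneg (sub_nonneg.2 g11) (sub_nonneg.2 g22), mul_nonneg (sub_nonneg.2 g21) ha2, mul_nonneg (sub_nonneg.2 g21) (sub_nonneg.2 g32), mul_nonneg (sub_nonneg.2 g31) hs2, mul_nonneg (sub_nonneg.2 g31) hb2, mul_nonneg (sub_nonneg.2 g31) (sub_nonneg.2 g32), mul_nonneg hs1 hs2, mul_nonneg hs1 ha2, mul_nonneg hs1 hb2, mul_nonneg ha1 hs2, mul_nonneg ha1 ha2, mul_nonneg ha1 hb2, mul_nonneg hb1 hs2, mul_nonneg hb1 ha2, mul_nonneg hb1 hb2]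
  · linarith [mul_nonneg hs1 (sub_nonneg.2 g12), mul_nonneg ha1 (sub_nonneg.2 g12), mul_nonneg hb1 (sub_nonneg.2 g22), mul_nonneg (sub_nonneg.2 g21) hs2, mul_nonneg (sub_nonneg.2 g21) ha2, mul_nonneg (sub_nonneg.2 g21) (sub_nonneg.2 g12), mul_nonneg (sub_nonneg.2 g31) hs2, mul_nonneg (sub_nonneg.2 g31) (sub_nonneg.2 g12), mul_nonneg hs1 hs2, mul_nonneg hs1 ha2, mul_nonneg hs1 hb2, mul_nonneg ha1 hs2, mul_nonneg ha1 ha2, mul_nonneg ha1 hb2, mul_nonneg hb1 hs2, mul_nonneg hb1 ha2, mul_nonneg hb1 hb2]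
theorem cRR {s1 a1 s2 a2 : ℝ} (h : NR s1 a1) (k : NR s2 a2) :
    NP ((a1*a2)) ((s1*s2)) ((a1*a2)) := by
  obtain ⟨hs1, ha1, g11, g21, g31⟩ := h
  obtain ⟨hs2, ha2, g12, g22, g32⟩ := k
  refine ⟨by positivity, by positivity, by positivity, ?_, ?_, ?_⟩
  · linarith [mul_nonneg hs1 (sub_nonneg.2 g32), mul_nonneg ha1 (sub_nonneg.2 g32), mul_nonneg (sub_nonneg.2 g11) (sub_nonneg.2 g32), mul_nonneg (sub_nonneg.2 g31) ha2, mul_nonneg hs1 hs2, mul_nonneg hs1 ha2, mul_nonneg ha1 hs2, mul_nonneg ha1 ha2]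
  · linarith [mul_nonneg hs1 (sub_nonneg.2 g32), mul_nonneg ha1 (sub_nonneg.2 g32), mul_nonneg (sub_nonneg.2 g11) (sub_nonneg.2 g32), mul_nonneg (sub_nonneg.2 g31) ha2, mul_nonneg hs1 hs2, mul_nonneg hs1 ha2, mul_nonneg ha1 hs2, mul_nonneg ha1 ha2]
  · linarith [auxRR hs1 ha1 (by linarith) (by linarith) (by linarith) hs2 ha2 (by linarith) (by linarith) (by linarith)]
theorem cRZ {s1 a1 s2 a2 b2 : ℝ} (h : NR s1 a1) (k : NZ s2 a2 b2) :
    NP ((500/733 : ℝ)^2 * (a1*a2+a1*b2)) ((500/733 : ℝ)^2 * (s1*s2)) ((500/733 : ℝ)^2 * (a1*a2)) := by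
  obtain ⟨hs1, ha1, g11, g21, g31⟩ := h
  obtain ⟨hs2, ha2, hb2, g12, g22, g32⟩ := k
  refine ⟨by positivity, by positivity, by positivity, ?_, ?_, ?_⟩
  · linarith [mul_nonneg ha1 (sub_nonneg.2 g22), mul_nonneg (sub_nonneg.2 g21) ha2, mul_nonneg (sub_nonneg.2 g21) hb2, mul_nonneg (sub_nonneg.2 g31) hs2, mul_nonneg (sub_nonneg.2 g31) ha2, mul_nonneg (sub_nonneg.2 g31) (sub_nonneg.2 g12), mul_nonneg (sub_nonneg.2 g31) (sub_nonneg.2 g32), mul_nonneg hs1 hs2, mul_nonneg hs1 ha2, mul_nonneg hs1 hb2, mul_nonneg ha1 hs2, mul_nonneg ha1 ha2, mul_nonneg ha1 hb2]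
  · linarith [mul_nonneg hs1 (sub_nonneg.2 g12), mul_nonneg ha1 (sub_nonneg.2 g22), mul_nonneg (sub_nonneg.2 g11) (sub_nonneg.2 g22), mul_nonneg (sub_nonneg.2 g21) ha2, mul_nonneg (sub_nonneg.2 g21) hb2, mul_nonneg (sub_nonneg.2 g31) hs2, mul_nonneg (sub_nonneg.2 g31) ha2, mul_nonneg (sub_nonneg.2 g31) (sub_nonneg.2 g12), mul_nonneg hs1 hs2, mul_nonneg hs1 ha2, mul_nonneg hs1 hb2, mul_nonneg ha1 hs2, mul_nonneg ha1 ha2, mul_nonneg ha1 hb2]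
  · linarith [auxRZ hs1 ha1 (by linarith) (by linarith) (by linarith) hs2 ha2 hb2 (by linarith) (by linarith) (by linarith)]
theorem cZZ {s1 a1 b1 s2 a2 b2 : ℝ} (h : NZ s1 a1 b1) (k : NZ s2 a2 b2) :
    NP ((500/733 : ℝ)^4 * (a1*a2+(a1*b2+b1*a2))) ((500/733 : ℝ)^4 * (s1*s2)) ((500/733 : ℝ)^4 * (a1*a2)) := by
  obtain ⟨hs1, ha1, hb1, g11, g21, g31⟩ := h
  obtain ⟨hs2, ha2, hb2, g12, g22, g32⟩ := k
  refine ⟨by positivity, by positivity, by positivity, ?_, ?_, ?_⟩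
  · linarith [mul_nonneg hs1 (sub_nonneg.2 g12), mul_nonneg hs1 (sub_nonneg.2 g22), mul_nonneg ha1 (sub_nonneg.2 g22), mul_nonneg hb1 (sub_nonneg.2 g22), mul_nonneg (sub_nonneg.2 g11) ha2, mul_nonneg (sub_nonneg.2 g11) hb2, mul_nonneg (sub_nonneg.2 g21) hs2, mul_nonneg (sub_nonneg.2 g21) ha2, mul_nonneg (sub_nonneg.2 g21) (sub_nonneg.2 g32), mul_nonneg (sub_nonneg.2 g31) (sub_nonneg.2 g22), mul_nonneg hs1 hs2, mul_nonneg hs1 ha2, mul_nonneg hs1 hb2, mul_nonneg ha1 hs2, mul_nonneg ha1 ha2, mul_nonneg ha1 hb2, mul_nonneg hb1 hs2, mul_nonneg hb1 ha2, mul_nonneg hb1 hb2]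
  · linarith [mul_nonneg hs1 (sub_nonneg.2 g12), mul_nonneg hs1 (sub_nonneg.2 g22), mul_nonneg ha1 (sub_nonneg.2 g22), mul_nonneg (sub_nonneg.2 g11) hs2, mul_nonneg (sub_nonneg.2 g11) hb2, mul_nonneg (sub_nonneg.2 g11) (sub_nonneg.2 g12), mul_nonneg (sub_nonneg.2 g11) (sub_nonneg.2 g22), mul_nonneg (sub_nonneg.2 g21) ha2, mul_nonneg hs1 hs2, mul_nonneg hs1 ha2, mul_nonneg hs1 hb2, mul_nonneg ha1 hs2, mul_nonneg ha1 ha2, mul_nonneg ha1 hb2, mul_nonneg hb1 hs2, mul_nonneg hb1 ha2, mul_nonneg hb1 hb2]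
  · linarith [auxZZ hs1 ha1 hb1 (by linarith) (by linarith) (by linarith) hs2 ha2 hb2 (by linarith) (by linarith) (by linarith)]

section Comb
open Classical

variable {V : Type*}

noncomputable def famD (G : SimpleGraph V) (S : Finset V) : Finset (Finset V) :=
  S.powerset.filter (fun F => IsDissocSet G F)

noncomputable def famA (G : SimpleGraph V) (S : Finset V) (t : V) : Finset (Finset V) :=
  (famD G S).filter (fun F => t ∉ F)

noncomputable def famB (G : SimpleGraph V) (S : Finset V) (t : V) : Finset (Finset V) :=
  (famD G S).filter (fun F => t ∈ F ∧ ∀ w ∈ F, ¬ G.Adj t w)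

noncomputable def famC (G : SimpleGraph V) (S : Finset V) (r t : V) : Finset (Finset V) :=
  (famD G S).filter (fun F => r ∈ F ∧ t ∈ F ∧ G.Adj r t)

theorem mem_famD {G : SimpleGraph V} {S F : Finset V} :
    F ∈ famD G S ↔ F ⊆ S ∧ IsDissocSet G F := by simp [famD]

theorem mem_famA {G : SimpleGraph V} {S F : Finset V} {t : V} :
    F ∈ famA G S t ↔ (F ⊆ S ∧ IsDissocSet G F) ∧ t ∉ F := by simp [famA, famD]

theorem mem_famB {G : SimpleGraph V} {S F : Finset V} {t : V} :
    F ∈ famB G S t ↔ (F ⊆ S ∧ IsDissocSet G F) ∧ t ∈ F ∧ ∀ w ∈ F, ¬ G.Adj t w := by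
  simp [famB, famD]

theorem mem_famC {G : SimpleGraph V} {S F : Finset V} {r t : V} :
    F ∈ famC G S r t ↔ (F ⊆ S ∧ IsDissocSet G F) ∧ r ∈ F ∧ t ∈ F ∧ G.Adj r t := by
  simp [famC, famD]

def DTop (X : Finset (Finset V)) (d : ℤ) (N : ℝ) : Prop :=
  (∀ F ∈ X, (F.card : ℤ) ≤ d) ∧ ((X.filter (fun F => (F.card : ℤ) = d)).card : ℝ) ≤ N

def DOk (d d' : ℤ) (N x : ℝ) : Prop := (d < d' ∧ 0 ≤ x) ∨ (d = d' ∧ N ≤ x)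

theorem DTop.ok {X : Finset (Finset V)} {d d' : ℤ} {N x : ℝ} (h : DTop X d N) (k : DOk d d' N x) :
    DTop X d' x := by
  rcases k with ⟨k, hx⟩ | ⟨rfl, hx⟩
  · refine ⟨fun F hF => (h.1 F hF).trans k.le, ?_⟩
    rw [Finset.filter_false_of_mem]
    · simpa using hx
    · intro F hF
      have := h.1 F hF
      omega
  · exact ⟨h.1, h.2.trans hx⟩

theorem DTop.union {X Y Z : Finset (Finset V)} {d : ℤ} {N N' : ℝ} (h : DTop X d N)
    (h' : DTop Y d N') (hZ : Z ⊆ X ∪ Y) : DTop Z d (N + N') := by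
  refine ⟨fun F hF => ?_, ?_⟩
  · rcases Finset.mem_union.1 (hZ hF) with h1 | h1
    · exact h.1 F h1
    · exact h'.1 F h1
  · have h1 : (Z.filter (fun F => (F.card : ℤ) = d)).card ≤
        (X.filter (fun F => (F.card : ℤ) = d)).card +
        (Y.filter (fun F => (F.card : ℤ) = d)).card := by
      refine le_trans (Finset.card_le_card ?_) (Finset.card_union_le _ _)
      rw [← Finset.filter_union]
      exact Finset.filter_subset_filter _ hZ
    have h2 : ((Z.filter (fun F => (F.card : ℤ) = d)).card : ℝ) ≤
        (X.filter (fun F => (F.card : ℤ) = d)).card +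
        (Y.filter (fun F => (F.card : ℤ) = d)).card := by exact_mod_cast h1
    linarith [h.2, h'.2]

theorem DTop.prod {X X1 X2 : Finset (Finset V)} {d1 d2 : ℤ} {N1 N2 : ℝ} {S1 S2 E : Finset V}
    (h1 : DTop X1 d1 N1) (h2 : DTop X2 d2 N2)
    (hX : ∀ F ∈ X, F ∩ S1 ∈ X1 ∧ F ∩ S2 ∈ X2 ∧ F = E ∪ ((F ∩ S1) ∪ (F ∩ S2)) ∧
      F.card = (F ∩ S1).card + (F ∩ S2).card + E.card) :
    DTop X (d1 + d2 + E.card) (N1 * N2) := by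
  refine ⟨fun F hF => ?_, ?_⟩
  · obtain ⟨a, b, _, c⟩ := hX F hF
    have := h1.1 _ a
    have := h2.1 _ b
    omega
  · have h3 : (X.filter (fun F => (F.card : ℤ) = d1 + d2 + E.card)).card ≤
        ((X1.filter (fun F => (F.card : ℤ) = d1)) ×ˢ
        (X2.filter (fun F => (F.card : ℤ) = d2))).card := by
      refine Finset.card_le_card_of_injOn (fun F => (F ∩ S1, F ∩ S2)) ?_ ?_
      · intro F hF
        simp only [Finset.coe_filter, Set.mem_setOf_eq] at hF
        obtain ⟨a, b, _, c⟩ := hX F hF.1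
        have e1 := h1.1 _ a
        have e2 := h2.1 _ b
        have e3 := hF.2
        simp only [Finset.coe_product, Set.mem_prod, Finset.mem_coe, Finset.mem_filter]
        refine ⟨⟨a, ?_⟩, b, ?_⟩ <;> omega
      · intro F hF F' hF' hh
        simp only [Finset.coe_filter, Set.mem_setOf_eq] at hF hF'
        simp only [Prod.mk.injEq] at hh
        rw [(hX F hF.1).2.2.1, (hX F' hF'.1).2.2.1, hh.1, hh.2]
    rw [Finset.card_product] at h3
    have h4 : ((X.filter (fun F => (F.card : ℤ) = d1 + d2 + E.card)).card : ℝ) ≤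
        ((X1.filter (fun F => (F.card : ℤ) = d1)).card : ℝ) *
        ((X2.filter (fun F => (F.card : ℤ) = d2)).card : ℝ) := by exact_mod_cast h3
    refine h4.trans (mul_le_mul h1.2 h2.2 (by positivity) ?_)
    exact le_trans (by positivity) h1.2

structure DJoin (G : SimpleGraph V) (S1 : Finset V) (t1 : V) (S2 : Finset V) (t2 : V)
    (S : Finset V) (r : V) : Prop where
  hS : S = {r} ∪ (S1 ∪ S2)
  r1 : r ∉ S1
  r2 : r ∉ S2
  dj : Disjoint S1 S2
  ne : ∀ u ∈ S1, ∀ v ∈ S2, ¬ G.Adj u v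
  a1 : ∀ w ∈ S1, (G.Adj r w ↔ w = t1)
  a2 : ∀ w ∈ S2, (G.Adj r w ↔ w = t2)

theorem DJoin.symm {G : SimpleGraph V} {S1 S2 S : Finset V} {t1 t2 r : V}
    (J : DJoin G S1 t1 S2 t2 S r) : DJoin G S2 t2 S1 t1 S r :=
  ⟨by rw [J.hS, Finset.union_comm S1], J.r2, J.r1, J.dj.symm,
    fun u hu v hv h => J.ne v hv u hu h.symm, J.a2, J.a1⟩

theorem IsDissocSet.mono {G : SimpleGraph V} {F F' : Finset V} (h : IsDissocSet G F)
    (hs : F' ⊆ F) : IsDissocSet G F' :=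
  fun v hv u hu w hw => h v (hs hv) u (hs hu) w (hs hw)

section
variable {G : SimpleGraph V} {S1 S2 S : Finset V} {t1 t2 r : V}

theorem DJoin.card (J : DJoin G S1 t1 S2 t2 S r) : S.card = S1.card + S2.card + 1 := by
  rw [J.hS, Finset.card_union_of_disjoint, Finset.card_union_of_disjoint J.dj]
  · simp; omega
  · simp [J.r1, J.r2]

theorem DJoin.split1 (J : DJoin G S1 t1 S2 t2 S r) {F : Finset V} (hF : F ⊆ S) (hr : r ∉ F) :
    F = ∅ ∪ ((F ∩ S1) ∪ (F ∩ S2)) ∧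
      F.card = (F ∩ S1).card + (F ∩ S2).card + (∅ : Finset V).card := by
  have e : F = ∅ ∪ ((F ∩ S1) ∪ (F ∩ S2)) := by
    ext x
    have := @hF x
    rw [J.hS] at this
    simp only [Finset.mem_union, Finset.mem_inter, Finset.mem_singleton] at *
    grind
  refine ⟨e, ?_⟩
  conv_lhs => rw [e]
  rw [Finset.empty_union, Finset.card_union_of_disjoint]
  · simp
  · exact J.dj.mono Finset.inter_subset_right Finset.inter_subset_right

theorem DJoin.split2 (J : DJoin G S1 t1 S2 t2 S r) {F : Finset V} (hF : F ⊆ S) (hr : r ∈ F) :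
    F = {r} ∪ ((F ∩ S1) ∪ (F ∩ S2)) ∧
      F.card = (F ∩ S1).card + (F ∩ S2).card + ({r} : Finset V).card := by
  have e : F = {r} ∪ ((F ∩ S1) ∪ (F ∩ S2)) := by
    ext x
    have := @hF x
    rw [J.hS] at this
    simp only [Finset.mem_union, Finset.mem_inter, Finset.mem_singleton] at *
    grind
  refine ⟨e, ?_⟩
  conv_lhs => rw [e]
  rw [Finset.card_union_of_disjoint, Finset.card_union_of_disjoint]
  · simp; omega
  · exact J.dj.mono Finset.inter_subset_right Finset.inter_subset_right
  · simp [J.r1, J.r2]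

theorem DJoin.topA (J : DJoin G S1 t1 S2 t2 S r) {d1 d2 : ℤ} {N1 N2 : ℝ}
    (h1 : DTop (famD G S1) d1 N1) (h2 : DTop (famD G S2) d2 N2) :
    DTop (famA G S r) (d1 + d2) (N1 * N2) := by
  have := DTop.prod (X := famA G S r) (S1 := S1) (S2 := S2) (E := ∅) h1 h2 ?_
  · simpa using this
  · intro F hF
    rw [mem_famA] at hF
    refine ⟨mem_famD.2 ⟨Finset.inter_subset_right, hF.1.2.mono Finset.inter_subset_left⟩,
      mem_famD.2 ⟨Finset.inter_subset_right, hF.1.2.mono Finset.inter_subset_left⟩,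
      J.split1 hF.1.1 hF.2⟩

theorem DJoin.topB (J : DJoin G S1 t1 S2 t2 S r) {d1 d2 : ℤ} {N1 N2 : ℝ}
    (h1 : DTop (famA G S1 t1) d1 N1) (h2 : DTop (famA G S2 t2) d2 N2) :
    DTop (famB G S r) (d1 + d2 + 1) (N1 * N2) := by
  have := DTop.prod (X := famB G S r) (S1 := S1) (S2 := S2) (E := {r}) h1 h2 ?_
  · simpa using this
  · intro F hF
    rw [mem_famB] at hF
    refine ⟨mem_famA.2 ⟨⟨Finset.inter_subset_right, hF.1.2.mono Finset.inter_subset_left⟩, ?_⟩,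
      mem_famA.2 ⟨⟨Finset.inter_subset_right, hF.1.2.mono Finset.inter_subset_left⟩, ?_⟩,
      J.split2 hF.1.1 hF.2.1⟩
    · intro h
      rw [Finset.mem_inter] at h
      exact hF.2.2 _ h.1 ((J.a1 _ h.2).2 rfl)
    · intro h
      rw [Finset.mem_inter] at h
      exact hF.2.2 _ h.1 ((J.a2 _ h.2).2 rfl)

theorem DJoin.topC (J : DJoin G S1 t1 S2 t2 S r) {d1 d2 : ℤ} {N1 N2 : ℝ}
    (h1 : DTop (famB G S1 t1) d1 N1) (h2 : DTop (famA G S2 t2) d2 N2) :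
    DTop ((famC G S r t1).filter (fun _ => t1 ∈ S1)) (d1 + d2 + 1) (N1 * N2) := by
  have := DTop.prod (X := (famC G S r t1).filter (fun _ => t1 ∈ S1))
    (S1 := S1) (S2 := S2) (E := {r}) h1 h2 ?_
  · simpa using this
  · intro F hF
    rw [Finset.mem_filter, mem_famC] at hF
    obtain ⟨⟨⟨hFS, hd⟩, hr, ht, hadj⟩, htS⟩ := hF
    refine ⟨mem_famB.2 ⟨⟨Finset.inter_subset_right, hd.mono Finset.inter_subset_left⟩, ?_, ?_⟩,
      mem_famA.2 ⟨⟨Finset.inter_subset_right, hd.mono Finset.inter_subset_left⟩, ?_⟩,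
      J.split2 hFS hr⟩
    · exact Finset.mem_inter.2 ⟨ht, htS⟩
    · intro w hw hww
      rw [Finset.mem_inter] at hw
      have := hd t1 ht r hr w hw.1 hadj.symm hww
      exact J.r1 (this ▸ hw.2)
    · intro h
      rw [Finset.mem_inter] at h
      have := hd r hr t1 ht t2 h.1 hadj ((J.a2 _ h.2).2 rfl)
      rw [← this] at h
      exact Finset.disjoint_left.1 J.dj htS h.2

theorem DJoin.cover (J : DJoin G S1 t1 S2 t2 S r) :
    famD G S ⊆ (famA G S r ∪ famB G S r) ∪ ((famC G S r t1).filter (fun _ => t1 ∈ S1) ∪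
      (famC G S r t2).filter (fun _ => t2 ∈ S2)) := by
  intro F hF
  rw [mem_famD] at hF
  simp only [Finset.mem_union, mem_famA, mem_famB, Finset.mem_filter, mem_famC]
  by_cases hr : r ∈ F
  · by_cases hw : ∀ w ∈ F, ¬ G.Adj r w
    · exact Or.inl (Or.inr ⟨hF, hr, hw⟩)
    · push Not at hw
      obtain ⟨w, hw, hadj⟩ := hw
      have hwS := hF.1 hw
      rw [J.hS] at hwS
      simp only [Finset.mem_union, Finset.mem_singleton] at hwS
      rcases hwS with h | h | h
      · exact absurd hadj (h ▸ G.irrefl)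
      · have := (J.a1 w h).1 hadj
        subst this
        exact Or.inr (Or.inl ⟨⟨hF, hr, hw, hadj⟩, h⟩)
      · have := (J.a2 w h).1 hadj
        subst this
        exact Or.inr (Or.inr ⟨⟨hF, hr, hw, hadj⟩, h⟩)
  · exact Or.inl (Or.inl ⟨hF, hr⟩)

theorem DJoin.attA (J : DJoin G S1 t1 S2 t2 S r) {F1 F2 : Finset V} (h1 : F1 ∈ famD G S1)
    (h2 : F2 ∈ famD G S2) : ∃ F ∈ famA G S r, F.card = F1.card + F2.card := by
  rw [mem_famD] at h1 h2
  refine ⟨F1 ∪ F2, mem_famA.2 ⟨⟨?_, ?_⟩, ?_⟩, Finset.card_union_of_disjoint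
    (J.dj.mono h1.1 h2.1)⟩
  · rw [J.hS]
    exact (Finset.union_subset_union h1.1 h2.1).trans Finset.subset_union_right
  · have hn : ∀ u ∈ F1, ∀ v ∈ F2, ¬ G.Adj u v := fun u hu v hv => J.ne u (h1.1 hu) v (h2.1 hv)
    have hn' : ∀ u ∈ F2, ∀ v ∈ F1, ¬ G.Adj u v := fun u hu v hv h => hn v hv u hu h.symm
    intro v hv u hu w hw
    have e1 := h1.2 v
    have e2 := h2.2 v
    simp only [Finset.mem_union] at hv hu hw
    grind
  · intro h
    rcases Finset.mem_union.1 h with h | h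
    · exact J.r1 (h1.1 h)
    · exact J.r2 (h2.1 h)

theorem DJoin.attB (J : DJoin G S1 t1 S2 t2 S r) {F1 F2 : Finset V} (h1 : F1 ∈ famA G S1 t1)
    (h2 : F2 ∈ famA G S2 t2) : ∃ F ∈ famB G S r, F.card = F1.card + F2.card + 1 := by
  rw [mem_famA] at h1 h2
  obtain ⟨F, hF, hc⟩ := J.attA (mem_famD.2 h1.1) (mem_famD.2 h2.1)
  have hn : ∀ u ∈ F1, ∀ v ∈ F2, ¬ G.Adj u v := fun u hu v hv => J.ne u (h1.1.1 hu) v (h2.1.1 hv)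
  have hn' : ∀ u ∈ F2, ∀ v ∈ F1, ¬ G.Adj u v := fun u hu v hv h => hn v hv u hu h.symm
  have hr1 : ∀ u ∈ F1, ¬ G.Adj r u := by
    intro u hu h
    exact h1.2 ((J.a1 u (h1.1.1 hu)).1 h ▸ hu)
  have hr2 : ∀ u ∈ F2, ¬ G.Adj r u := by
    intro u hu h
    exact h2.2 ((J.a2 u (h2.1.1 hu)).1 h ▸ hu)
  have hr1' : ∀ u ∈ F1, ¬ G.Adj u r := fun u hu h => hr1 u hu h.symm
  have hr2' : ∀ u ∈ F2, ¬ G.Adj u r := fun u hu h => hr2 u hu h.symm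
  have hrr : ¬ G.Adj r r := G.irrefl
  refine ⟨{r} ∪ (F1 ∪ F2), mem_famB.2 ⟨⟨?_, ?_⟩, ?_, ?_⟩, ?_⟩
  · rw [J.hS]
    exact Finset.union_subset_union subset_rfl (Finset.union_subset_union h1.1.1 h2.1.1)
  · intro v hv u hu w hw
    have e1 := h1.1.2 v
    have e2 := h2.1.2 v
    simp only [Finset.mem_union, Finset.mem_singleton] at hv hu hw
    grind
  · simp
  · intro w hw
    simp only [Finset.mem_union, Finset.mem_singleton] at hw
    grind
  · rw [Finset.card_union_of_disjoint, Finset.card_union_of_disjoint (J.dj.mono h1.1.1 h2.1.1)]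
    · simp; omega
    · have := J.r1
      have := J.r2
      simp only [Finset.disjoint_singleton_left, Finset.mem_union]
      rintro (h | h)
      · exact J.r1 (h1.1.1 h)
      · exact J.r2 (h2.1.1 h)

theorem DJoin.attC (J : DJoin G S1 t1 S2 t2 S r) {F1 F2 : Finset V} (h1 : F1 ∈ famB G S1 t1)
    (h2 : F2 ∈ famA G S2 t2) : ∃ F ∈ famD G S, F.card = F1.card + F2.card + 1 := by
  rw [mem_famA] at h2
  rw [mem_famB] at h1
  have hn : ∀ u ∈ F1, ∀ v ∈ F2, ¬ G.Adj u v := fun u hu v hv => J.ne u (h1.1.1 hu) v (h2.1.1 hv)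
  have hn' : ∀ u ∈ F2, ∀ v ∈ F1, ¬ G.Adj u v := fun u hu v hv h => hn v hv u hu h.symm
  have hr1 : ∀ u ∈ F1, G.Adj r u → u = t1 := by
    intro u hu h
    exact (J.a1 u (h1.1.1 hu)).1 h
  have hr2 : ∀ u ∈ F2, ¬ G.Adj r u := by
    intro u hu h
    exact h2.2 ((J.a2 u (h2.1.1 hu)).1 h ▸ hu)
  have hr1' : ∀ u ∈ F1, G.Adj u r → u = t1 := fun u hu h => hr1 u hu h.symm
  have hr2' : ∀ u ∈ F2, ¬ G.Adj u r := fun u hu h => hr2 u hu h.symm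
  have hrr : ¬ G.Adj r r := G.irrefl
  have ht := h1.2.1
  have htn := h1.2.2
  refine ⟨{r} ∪ (F1 ∪ F2), mem_famD.2 ⟨?_, ?_⟩, ?_⟩
  · rw [J.hS]
    exact Finset.union_subset_union subset_rfl (Finset.union_subset_union h1.1.1 h2.1.1)
  · intro v hv u hu w hw
    have e1 := h1.1.2 v
    have e2 := h2.1.2 v
    simp only [Finset.mem_union, Finset.mem_singleton] at hv hu hw
    grind
  · rw [Finset.card_union_of_disjoint, Finset.card_union_of_disjoint (J.dj.mono h1.1.1 h2.1.1)]
    · simp; omega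
    · simp only [Finset.disjoint_singleton_left, Finset.mem_union]
      rintro (h | h)
      · exact J.r1 (h1.1.1 h)
      · exact J.r2 (h2.1.1 h)

end

end Comb

section Branch
open Classical

variable {V : Type*}

theorem DOk.scale {d d' : ℤ} {N x c : ℝ} (h : DOk d d' N x) (hc : 0 ≤ c) (e : ℤ) :
    DOk (e + d) (e + d') (c * N) (c * x) := by
  rcases h with ⟨h, hx⟩ | ⟨h, hx⟩
  · exact Or.inl ⟨by omega, mul_nonneg hc hx⟩
  · exact Or.inr ⟨by omega, mul_le_mul_of_nonneg_left hx hc⟩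

noncomputable def wt (n : ℕ) (M : ℤ) : ℝ := (1.466 : ℝ) ^ (4 * (n : ℤ) - 5 * M)

theorem wt_pos (n : ℕ) (M : ℤ) : 0 < wt n M := by unfold wt; positivity

theorem wt_mul (n1 n2 : ℕ) (M1 M2 e : ℤ) :
    wt n1 M1 * wt n2 M2 = wt (n1 + n2 + 1) (M1 + M2 + e) * (1.466 : ℝ) ^ (5 * e - 4) := by
  unfold wt
  rw [← zpow_add₀ (by norm_num), ← zpow_add₀ (by norm_num)]
  congr 1
  push_cast
  ring

structure Br (G : SimpleGraph V) (S : Finset V) (t : V) (M dA dB : ℤ) (k s a b : ℝ) : Prop where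
  D : DTop (famD G S) M (wt S.card M * (k * s))
  A : DTop (famA G S t) (M + dA) (wt S.card M * (k * a))
  B : DTop (famB G S t) (M + dB) (wt S.card M * (k * b))

theorem Br.join {G : SimpleGraph V} {S1 S2 S : Finset V} {t1 t2 r : V}
    {M1 M2 dA1 dA2 dB1 dB2 : ℤ} {k1 k2 s1 s2 a1 a2 b1 b2 : ℝ}
    (J : DJoin G S1 t1 S2 t2 S r)
    (h1 : Br G S1 t1 M1 dA1 dB1 k1 s1 a1 b1) (h2 : Br G S2 t2 M2 dA2 dB2 k2 s2 a2 b2)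
    (e dA dB : ℤ) (k f xA xB xC xC' s a b : ℝ) (hk : 0 ≤ k)
    (hf : (1.466 : ℝ) ^ (5 * e - 4) * (k1 * k2) = k * f)
    (hA : DOk 0 (e + dA) (f * (s1 * s2)) a)
    (hB : DOk (dA1 + dA2 + 1) (e + dB) (f * (a1 * a2)) b)
    (pA : DOk 0 e (f * (s1 * s2)) xA)
    (pB : DOk (dA1 + dA2 + 1) e (f * (a1 * a2)) xB)
    (pC : DOk (dB1 + dA2 + 1) e (f * (b1 * a2)) xC)
    (pC' : DOk (dB2 + dA1 + 1) e (f * (b2 * a1)) xC')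
    (hs : (xA + xB) + (xC + xC') = s) :
    Br G S r (M1 + M2 + e) dA dB k s a b := by
  have key : ∀ x y : ℝ, (wt S1.card M1 * (k1 * x)) * (wt S2.card M2 * (k2 * y)) =
      (wt S.card (M1 + M2 + e) * k) * (f * (x * y)) := by
    intro x y
    have := wt_mul S1.card S2.card M1 M2 e
    rw [← J.card] at this
    calc _ = (wt S1.card M1 * wt S2.card M2) * (k1 * k2) * (x * y) := by ring
      _ = wt S.card (M1 + M2 + e) * ((1.466 : ℝ) ^ (5 * e - 4) * (k1 * k2)) * (x * y) := by
        rw [this]; ring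
      _ = _ := by rw [hf]; ring
  have key' : ∀ x y : ℝ, (wt S2.card M2 * (k2 * x)) * (wt S1.card M1 * (k1 * y)) =
      (wt S.card (M1 + M2 + e) * k) * (f * (x * y)) := by
    intro x y
    rw [mul_comm, key]; ring
  have hc : 0 ≤ wt S.card (M1 + M2 + e) * k := mul_nonneg (wt_pos _ _).le hk
  have T1 := J.topA h1.D h2.D
  have T2 := J.topB h1.A h2.A
  have T3 := J.topC h1.B h2.A
  have T4 := J.symm.topC h2.B h1.A
  rw [key] at T1 T2 T3
  rw [key'] at T4
  have T1 : DTop (famA G S r) (M1 + M2 + 0) (wt S.card (M1 + M2 + e) * k * (f * (s1 * s2))) := by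
    rw [add_zero]; exact T1
  have e2 : M1 + dA1 + (M2 + dA2) + 1 = M1 + M2 + (dA1 + dA2 + 1) := by ring
  have e3 : M1 + dB1 + (M2 + dA2) + 1 = M1 + M2 + (dB1 + dA2 + 1) := by ring
  have e4 : M2 + dB2 + (M1 + dA1) + 1 = M1 + M2 + (dB2 + dA1 + 1) := by ring
  rw [e2] at T2
  rw [e3] at T3
  rw [e4] at T4
  refine ⟨?_, ?_, ?_⟩
  · have := ((T1.ok (pA.scale hc _)).union (T2.ok (pB.scale hc _)) subset_rfl).union
      ((T3.ok (pC.scale hc _)).union (T4.ok (pC'.scale hc _)) subset_rfl) J.cover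
    convert this using 1
    rw [← hs]; ring
  · have := T1.ok (hA.scale hc _)
    convert this using 1 <;> ring
  · have := T2.ok (hB.scale hc _)
    convert this using 1 <;> ring

def IP (G : SimpleGraph V) (S : Finset V) (t : V) : Prop := ∃ (M : ℤ) (s a b : ℝ), NP s a b ∧
  Br G S t M (-1) 0 (733/500) s a b ∧ ∃ F ∈ famB G S t, (F.card : ℤ) = M
def IQ (G : SimpleGraph V) (S : Finset V) (t : V) : Prop := ∃ (M : ℤ) (s a b : ℝ), NQ s a b ∧
  Br G S t M (-1) (-1) ((733/500)^2) s a b ∧ ∃ F ∈ famD G S, (F.card : ℤ) = M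
def IR (G : SimpleGraph V) (S : Finset V) (t : V) : Prop := ∃ (M : ℤ) (s a : ℝ), NR s a ∧
  Br G S t M 0 0 1 s a 0 ∧ ∃ F ∈ famA G S t, (F.card : ℤ) = M
def IZ (G : SimpleGraph V) (S : Finset V) (t : V) : Prop := ∃ (M : ℤ) (s a b : ℝ), NZ s a b ∧
  Br G S t M 0 0 ((500/733)^2) s a b ∧ ∃ F ∈ famA G S t, (F.card : ℤ) = M

def DInv (G : SimpleGraph V) (S : Finset V) (t : V) : Prop :=
  IP G S t ∨ IQ G S t ∨ IR G S t ∨ IZ G S t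

theorem famA_sub {G : SimpleGraph V} {S F : Finset V} {t : V} (h : F ∈ famA G S t) :
    F ∈ famD G S := (Finset.mem_filter.1 h).1
theorem famB_sub {G : SimpleGraph V} {S F : Finset V} {t : V} (h : F ∈ famB G S t) :
    F ∈ famD G S := (Finset.mem_filter.1 h).1

theorem DOk.eq' {d d' : ℤ} {N x : ℝ} (h : d = d') (h' : N = x) : DOk d d' N x :=
  Or.inr ⟨h, h'.le⟩
theorem DOk.lt' {d d' : ℤ} {N : ℝ} (h : d < d') : DOk d d' N 0 := Or.inl ⟨h, le_rfl⟩

section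
variable {G : SimpleGraph V} {S1 S2 S : Finset V} {t1 t2 r : V}

theorem jPP (J : DJoin G S1 t1 S2 t2 S r) (h1 : IP G S1 t1) (h2 : IP G S2 t2) : IR G S r := by
  obtain ⟨M1, s1, a1, b1, n1, B1, F1, m1, c1⟩ := h1
  obtain ⟨M2, s2, a2, b2, n2, B2, F2, m2, c2⟩ := h2
  refine ⟨_, _, _, cPP n1 n2, Br.join J B1 B2 0 0 0 1 ((500/733)^2)
    ((500/733)^2 * (s1*s2)) 0 ((500/733)^2 * (b1*a2)) ((500/733)^2 * (b2*a1)) _ _ _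
    (by norm_num) (by norm_num) (DOk.eq' (by norm_num) rfl) (DOk.lt' (by norm_num))
    (DOk.eq' (by norm_num) rfl) (DOk.lt' (by norm_num)) (DOk.eq' (by norm_num) rfl)
    (DOk.eq' (by norm_num) rfl) (by ring), ?_⟩
  obtain ⟨F, hF, hc⟩ := J.attA (famB_sub m1) (famB_sub m2)
  exact ⟨F, hF, by omega⟩

theorem jPQ (J : DJoin G S1 t1 S2 t2 S r) (h1 : IP G S1 t1) (h2 : IQ G S2 t2) : IR G S r := by
  obtain ⟨M1, s1, a1, b1, n1, B1, F1, m1, c1⟩ := h1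
  obtain ⟨M2, s2, a2, b2, n2, B2, F2, m2, c2⟩ := h2
  refine ⟨_, _, _, cPQ n1 n2, Br.join J B1 B2 0 0 0 1 (500/733)
    ((500/733) * (s1*s2)) 0 ((500/733) * (b1*a2)) 0 _ _ _
    (by norm_num) (by norm_num) (DOk.eq' (by norm_num) rfl) (DOk.lt' (by norm_num))
    (DOk.eq' (by norm_num) rfl) (DOk.lt' (by norm_num)) (DOk.eq' (by norm_num) rfl)
    (DOk.lt' (by norm_num)) (by ring), ?_⟩
  obtain ⟨F, hF, hc⟩ := J.attA (famB_sub m1) m2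
  exact ⟨F, hF, by omega⟩

theorem jQQ (J : DJoin G S1 t1 S2 t2 S r) (h1 : IQ G S1 t1) (h2 : IQ G S2 t2) : IR G S r := by
  obtain ⟨M1, s1, a1, b1, n1, B1, F1, m1, c1⟩ := h1
  obtain ⟨M2, s2, a2, b2, n2, B2, F2, m2, c2⟩ := h2
  refine ⟨_, _, _, cQQ n1 n2, Br.join J B1 B2 0 0 0 1 1
    (s1*s2) 0 0 0 _ _ _
    (by norm_num) (by norm_num) (DOk.eq' (by norm_num) (by ring)) (DOk.lt' (by norm_num))
    (DOk.eq' (by norm_num) (by ring)) (DOk.lt' (by norm_num)) (DOk.lt' (by norm_num))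
    (DOk.lt' (by norm_num)) (by ring), ?_⟩
  obtain ⟨F, hF, hc⟩ := J.attA m1 m2
  exact ⟨F, hF, by omega⟩

theorem jQR (J : DJoin G S1 t1 S2 t2 S r) (h1 : IQ G S1 t1) (h2 : IR G S2 t2) : IZ G S r := by
  obtain ⟨M1, s1, a1, b1, n1, B1, F1, m1, c1⟩ := h1
  obtain ⟨M2, s2, a2, n2, B2, F2, m2, c2⟩ := h2
  refine ⟨_, _, _, _, cQR n1 n2, Br.join J B1 B2 0 0 0 ((500/733)^2) 1
    (s1*s2) (a1*a2) (b1*a2) 0 _ _ _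
    (by norm_num) (by norm_num) (DOk.eq' (by norm_num) (by ring)) (DOk.eq' (by norm_num) (by ring))
    (DOk.eq' (by norm_num) (by ring)) (DOk.eq' (by norm_num) (by ring))
    (DOk.eq' (by norm_num) (by ring))
    (DOk.eq' (by norm_num) (by ring)) (by ring), ?_⟩
  obtain ⟨F, hF, hc⟩ := J.attA m1 (famA_sub m2)
  exact ⟨F, hF, by omega⟩

theorem jQZ (J : DJoin G S1 t1 S2 t2 S r) (h1 : IQ G S1 t1) (h2 : IZ G S2 t2) : IZ G S r := by
  obtain ⟨M1, s1, a1, b1, n1, B1, F1, m1, c1⟩ := h1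
  obtain ⟨M2, s2, a2, b2, n2, B2, F2, m2, c2⟩ := h2
  refine ⟨_, _, _, _, cQZ n1 n2, Br.join J B1 B2 0 0 0 ((500/733)^2) ((500/733)^2)
    ((500/733)^2 * (s1*s2)) ((500/733)^2 * (a1*a2)) ((500/733)^2 * (b1*a2))
    ((500/733)^2 * (b2*a1)) _ _ _
    (by norm_num) (by norm_num) (DOk.eq' (by norm_num) (by ring)) (DOk.eq' (by norm_num) (by ring))
    (DOk.eq' (by norm_num) (by ring)) (DOk.eq' (by norm_num) (by ring))
    (DOk.eq' (by norm_num) (by ring))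
    (DOk.eq' (by norm_num) (by ring)) (by ring), ?_⟩
  obtain ⟨F, hF, hc⟩ := J.attA m1 (famA_sub m2)
  exact ⟨F, hF, by omega⟩

theorem jPR (J : DJoin G S1 t1 S2 t2 S r) (h1 : IP G S1 t1) (h2 : IR G S2 t2) : IQ G S r := by
  obtain ⟨M1, s1, a1, b1, n1, B1, F1, m1, c1⟩ := h1
  obtain ⟨M2, s2, a2, n2, B2, F2, m2, c2⟩ := h2
  refine ⟨_, _, _, _, cPR n1 n2, Br.join J B1 B2 1 (-1) (-1) ((733/500)^2) 1
    0 0 (b1*a2) 0 _ _ _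
    (by norm_num) (by norm_num) (DOk.eq' (by norm_num) (by ring)) (DOk.eq' (by norm_num) (by ring))
    (DOk.lt' (by norm_num)) (DOk.lt' (by norm_num)) (DOk.eq' (by norm_num) (by ring))
    (DOk.lt' (by norm_num)) (by ring), ?_⟩
  obtain ⟨F, hF, hc⟩ := J.attC m1 m2
  exact ⟨F, hF, by omega⟩

theorem jPZ (J : DJoin G S1 t1 S2 t2 S r) (h1 : IP G S1 t1) (h2 : IZ G S2 t2) : IQ G S r := by
  obtain ⟨M1, s1, a1, b1, n1, B1, F1, m1, c1⟩ := h1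
  obtain ⟨M2, s2, a2, b2, n2, B2, F2, m2, c2⟩ := h2
  refine ⟨_, _, _, _, cPZ n1 n2, Br.join J B1 B2 1 (-1) (-1) ((733/500)^2) ((500/733)^2)
    0 0 ((500/733)^2 * (b1*a2)) 0 _ _ _
    (by norm_num) (by norm_num) (DOk.eq' (by norm_num) (by ring)) (DOk.eq' (by norm_num) (by ring))
    (DOk.lt' (by norm_num)) (DOk.lt' (by norm_num)) (DOk.eq' (by norm_num) (by ring))
    (DOk.lt' (by norm_num)) (by ring), ?_⟩
  obtain ⟨F, hF, hc⟩ := J.attC m1 m2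
  exact ⟨F, hF, by omega⟩

theorem jRR (J : DJoin G S1 t1 S2 t2 S r) (h1 : IR G S1 t1) (h2 : IR G S2 t2) : IP G S r := by
  obtain ⟨M1, s1, a1, n1, B1, F1, m1, c1⟩ := h1
  obtain ⟨M2, s2, a2, n2, B2, F2, m2, c2⟩ := h2
  refine ⟨_, _, _, _, cRR n1 n2, Br.join J B1 B2 1 (-1) 0 (733/500) 1
    0 (a1*a2) 0 0 _ _ _
    (by norm_num) (by norm_num) (DOk.eq' (by norm_num) (by ring)) (DOk.eq' (by norm_num) (by ring))
    (DOk.lt' (by norm_num)) (DOk.eq' (by norm_num) (by ring)) (DOk.eq' (by norm_num) (by ring))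
    (DOk.eq' (by norm_num) (by ring)) (by ring), ?_⟩
  obtain ⟨F, hF, hc⟩ := J.attB m1 m2
  exact ⟨F, hF, by omega⟩

theorem jRZ (J : DJoin G S1 t1 S2 t2 S r) (h1 : IR G S1 t1) (h2 : IZ G S2 t2) : IP G S r := by
  obtain ⟨M1, s1, a1, n1, B1, F1, m1, c1⟩ := h1
  obtain ⟨M2, s2, a2, b2, n2, B2, F2, m2, c2⟩ := h2
  refine ⟨_, _, _, _, cRZ n1 n2, Br.join J B1 B2 1 (-1) 0 (733/500) ((500/733)^2)
    0 ((500/733)^2 * (a1*a2)) 0 ((500/733)^2 * (b2*a1)) _ _ _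
    (by norm_num) (by norm_num) (DOk.eq' (by norm_num) (by ring)) (DOk.eq' (by norm_num) (by ring))
    (DOk.lt' (by norm_num)) (DOk.eq' (by norm_num) (by ring)) (DOk.eq' (by norm_num) (by ring))
    (DOk.eq' (by norm_num) (by ring)) (by ring), ?_⟩
  obtain ⟨F, hF, hc⟩ := J.attB m1 m2
  exact ⟨F, hF, by omega⟩

theorem jZZ (J : DJoin G S1 t1 S2 t2 S r) (h1 : IZ G S1 t1) (h2 : IZ G S2 t2) : IP G S r := by
  obtain ⟨M1, s1, a1, b1, n1, B1, F1, m1, c1⟩ := h1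
  obtain ⟨M2, s2, a2, b2, n2, B2, F2, m2, c2⟩ := h2
  refine ⟨_, _, _, _, cZZ n1 n2, Br.join J B1 B2 1 (-1) 0 (733/500) ((500/733)^4)
    0 ((500/733)^4 * (a1*a2)) ((500/733)^4 * (b1*a2)) ((500/733)^4 * (b2*a1)) _ _ _
    (by norm_num) (by norm_num) (DOk.eq' (by norm_num) (by ring)) (DOk.eq' (by norm_num) (by ring))
    (DOk.lt' (by norm_num)) (DOk.eq' (by norm_num) (by ring)) (DOk.eq' (by norm_num) (by ring))
    (DOk.eq' (by norm_num) (by ring)) (by ring), ?_⟩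
  obtain ⟨F, hF, hc⟩ := J.attB m1 m2
  exact ⟨F, hF, by omega⟩

theorem DInv.join (J : DJoin G S1 t1 S2 t2 S r) (h1 : DInv G S1 t1) (h2 : DInv G S2 t2) :
    DInv G S r := by
  rcases h1 with h1 | h1 | h1 | h1 <;> rcases h2 with h2 | h2 | h2 | h2
  · exact Or.inr (Or.inr (Or.inl (jPP J h1 h2)))
  · exact Or.inr (Or.inr (Or.inl (jPQ J h1 h2)))
  · exact Or.inr (Or.inl (jPR J h1 h2))
  · exact Or.inr (Or.inl (jPZ J h1 h2))
  · exact Or.inr (Or.inr (Or.inl (jPQ J.symm h2 h1)))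
  · exact Or.inr (Or.inr (Or.inl (jQQ J h1 h2)))
  · exact Or.inr (Or.inr (Or.inr (jQR J h1 h2)))
  · exact Or.inr (Or.inr (Or.inr (jQZ J h1 h2)))
  · exact Or.inr (Or.inl (jPR J.symm h2 h1))
  · exact Or.inr (Or.inr (Or.inr (jQR J.symm h2 h1)))
  · exact Or.inl (jRR J h1 h2)
  · exact Or.inl (jRZ J h1 h2)
  · exact Or.inr (Or.inl (jPZ J.symm h2 h1))
  · exact Or.inr (Or.inr (Or.inr (jQZ J.symm h2 h1)))
  · exact Or.inl (jRZ J.symm h2 h1)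
  · exact Or.inl (jZZ J h1 h2)

theorem DInv.empty (G : SimpleGraph V) (t : V) : DInv G ∅ t := by
  have hD : famD G (∅ : Finset V) = {∅} := by
    ext F
    rw [mem_famD, Finset.mem_singleton, Finset.subset_empty]
    exact ⟨fun h => h.1, fun h => ⟨h, by subst h; intro v hv; simp at hv⟩⟩
  have hA : famA G (∅ : Finset V) t = {∅} := by
    rw [famA, hD]; ext F; simp; rintro rfl; simp
  have hB : famB G (∅ : Finset V) t = ∅ := by
    rw [famB, hD]; ext F; simp; rintro rfl; simp
  refine Or.inr (Or.inr (Or.inl ⟨0, 1, 1, ?_, ⟨?_, ?_, ?_⟩, ∅, ?_, ?_⟩))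
  · constructor <;> norm_num
  · rw [hD]; constructor <;> simp [wt, Finset.filter_singleton]
  · rw [hA]; constructor <;> simp [wt, Finset.filter_singleton]
  · rw [hB]; constructor <;> simp
  · rw [hA]; simp
  · simp

theorem DInv.bound {t : V} (h : DInv G S t) : ∃ M : ℤ, (∃ F ∈ famD G S, (F.card : ℤ) = M) ∧
    DTop (famD G S) M (wt S.card M * (1.466 : ℝ)^2) := by
  rcases h with ⟨M, s, a, b, n, B, F, m, c⟩ | ⟨M, s, a, b, n, B, F, m, c⟩ |
    ⟨M, s, a, n, B, F, m, c⟩ | ⟨M, s, a, b, n, B, F, m, c⟩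
  · refine ⟨M, ⟨F, famB_sub m, c⟩, B.D.ok (Or.inr ⟨rfl, ?_⟩)⟩
    refine mul_le_mul_of_nonneg_left ?_ (wt_pos _ _).le
    linarith [n.g1, n.hb]
  · refine ⟨M, ⟨F, m, c⟩, B.D.ok (Or.inr ⟨rfl, ?_⟩)⟩
    refine mul_le_mul_of_nonneg_left ?_ (wt_pos _ _).le
    linarith [n.g3]
  · refine ⟨M, ⟨F, famA_sub m, c⟩, B.D.ok (Or.inr ⟨rfl, ?_⟩)⟩
    refine mul_le_mul_of_nonneg_left ?_ (wt_pos _ _).le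
    linarith [n.g1, n.ha]
  · refine ⟨M, ⟨F, famA_sub m, c⟩, B.D.ok (Or.inr ⟨rfl, ?_⟩)⟩
    refine mul_le_mul_of_nonneg_left ?_ (wt_pos _ _).le
    linarith [n.g3, n.ha]

theorem final_bound [Fintype V] {t : V} (h : DInv G Finset.univ t) : (numMaxDissoc G : ℝ) ≤
    (1.466 : ℝ) ^ ((4 * (Fintype.card V : ℤ) - 5 * (dissocNum G : ℤ) + 2)) := by
  obtain ⟨M, ⟨F, hF, hc⟩, T⟩ := h.bound
  have hM : (dissocNum G : ℤ) = M := by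
    rw [← hc]
    norm_cast
    refine IsGreatest.csSup_eq ⟨⟨F, (mem_famD.1 hF).2, rfl⟩, ?_⟩
    rintro n ⟨F', hF', rfl⟩
    have := T.1 F' (mem_famD.2 ⟨Finset.subset_univ _, hF'⟩)
    omega
  have h2 := T.2
  have e : numMaxDissoc G = ((famD G Finset.univ).filter (fun F => (F.card : ℤ) = M)).card := by
    rw [numMaxDissoc, ← Set.ncard_coe_finset]
    congr 1
    ext F'
    simp [mem_famD, IsMaxDissocSet, ← hM]
  rw [e, hM, zpow_add₀ (by norm_num)]
  refine h2.trans (le_of_eq ?_)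
  simp only [wt, Finset.card_univ]
  norm_cast
end
end Branch

section TreePart
open Classical

variable {V : Type*} [Fintype V] {G : SimpleGraph V}

noncomputable def brD (G : SimpleGraph V) (p s : V) : Finset V :=
  Finset.univ.filter (fun w => ∃ q : G.Walk s w, p ∉ q.support)

theorem mem_brD {p s w : V} : w ∈ brD G p s ↔ ∃ q : G.Walk s w, p ∉ q.support := by
  simp [brD]

theorem acyc_key (hG : G.IsAcyclic) {s t p : V} (ht : G.Adj s t) (hp : G.Adj s p)
    (q : G.Walk t p) (hq : s ∉ q.support) : t = p := by
  by_contra hne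
  have h1 : q.bypass.IsPath := q.bypass_isPath
  have h2 : (SimpleGraph.Walk.cons ht.symm (SimpleGraph.Walk.cons hp SimpleGraph.Walk.nil)).IsPath := by
    simp [SimpleGraph.Walk.cons_isPath_iff, hp.ne, ht.ne', hne]
  have := hG.path_unique ⟨_, h1⟩ ⟨_, h2⟩
  have h3 : q.bypass = _ := congrArg Subtype.val this
  apply hq
  apply q.support_bypass_subset
  rw [h3]
  simp

theorem brD_not_mem {s t : V} : s ∉ brD G s t := by
  rw [mem_brD]
  rintro ⟨q, hq⟩
  exact hq q.end_mem_support

theorem brD_self {p s : V} (h : p ≠ s) : s ∈ brD G p s :=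
  mem_brD.2 ⟨SimpleGraph.Walk.nil, by simpa using h⟩

theorem brD_sub (hG : G.IsAcyclic) {p s t : V} (hp : G.Adj p s) (ht : G.Adj s t) (hne : t ≠ p) :
    brD G s t ⊆ brD G p s := by
  intro w hw
  obtain ⟨q, hq⟩ := mem_brD.1 hw
  refine mem_brD.2 ⟨SimpleGraph.Walk.cons ht q, ?_⟩
  rw [SimpleGraph.Walk.support_cons, List.mem_cons]
  rintro (h | h)
  · exact hp.ne h
  · exact hne (acyc_key hG ht hp.symm (q.takeUntil p h)
      (fun h' => hq (q.support_takeUntil_subset h h')))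

theorem brD_cover {s w : V} (hw : w ≠ s) (q : G.Walk s w) :
    ∃ t, G.Adj s t ∧ t ∈ q.support ∧ w ∈ brD G s t := by
  have hP := q.bypass_isPath
  have hs := q.support_bypass_subset
  generalize q.bypass = q' at hP hs
  cases q' with
  | nil => exact absurd rfl hw
  | @cons _ t _ h q'' =>
    rw [SimpleGraph.Walk.cons_isPath_iff] at hP
    refine ⟨t, h, hs (by simp), mem_brD.2 ⟨q'', hP.2⟩⟩

theorem brD_eq (hG : G.IsAcyclic) {p s : V} (hp : G.Adj p s) :
    brD G p s = {s} ∪ ((G.neighborFinset s).erase p).biUnion (brD G s) := by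
  ext w
  simp only [Finset.mem_union, Finset.mem_singleton, Finset.mem_biUnion, Finset.mem_erase,
    SimpleGraph.mem_neighborFinset]
  constructor
  · intro h
    by_cases hw : w = s
    · exact Or.inl hw
    · obtain ⟨q, hq⟩ := mem_brD.1 h
      obtain ⟨t, h1, h2, h3⟩ := brD_cover hw q
      exact Or.inr ⟨t, ⟨fun h => hq (h ▸ h2), h1⟩, h3⟩
  · rintro (rfl | ⟨t, ⟨h1, h2⟩, h3⟩)
    · exact brD_self hp.ne
    · exact brD_sub hG hp h2 h1 h3

theorem brD_adj {s t w : V} (hG : G.IsAcyclic) (ht : G.Adj s t) (hw : w ∈ brD G s t) :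
    G.Adj s w ↔ w = t := by
  constructor
  · intro h
    obtain ⟨q, hq⟩ := mem_brD.1 hw
    exact (acyc_key hG ht h q hq).symm
  · rintro rfl
    exact ht

theorem brD_disj {s t u v : V} (hG : G.IsAcyclic) (ht : G.Adj s t) {t' : V} (ht' : G.Adj s t')
    (hne : t ≠ t') (hu : u ∈ brD G s t) (hv : v ∈ brD G s t') : u ≠ v ∧ ¬ G.Adj u v := by
  obtain ⟨q, hq⟩ := mem_brD.1 hu
  obtain ⟨q', hq'⟩ := mem_brD.1 hv
  constructor
  · rintro rfl
    refine hne (acyc_key hG ht ht' (q.append q'.reverse) ?_)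
    rw [SimpleGraph.Walk.mem_support_append_iff, SimpleGraph.Walk.support_reverse,
      List.mem_reverse]
    tauto
  · intro h
    refine hne (acyc_key hG ht ht' (q.append (SimpleGraph.Walk.cons h q'.reverse)) ?_)
    rw [SimpleGraph.Walk.mem_support_append_iff, SimpleGraph.Walk.support_cons, List.mem_cons,
      SimpleGraph.Walk.support_reverse, List.mem_reverse]
    rintro (h' | h' | h')
    · exact hq h'
    · exact hq (h' ▸ q.end_mem_support)
    · exact hq' h'

theorem node (hG : G.IsAcyclic) (s : V) (ch : Finset V) (hch : ∀ t ∈ ch, G.Adj s t)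
    (hc : ch.card ≤ 2) (ih : ∀ t ∈ ch, DInv G (brD G s t) t) :
    DInv G ({s} ∪ ch.biUnion (brD G s)) s := by
  have h3 : ch.card = 0 ∨ ch.card = 1 ∨ ch.card = 2 := by omega
  rcases h3 with h | h | h
  · rw [Finset.card_eq_zero] at h
    subst h
    refine DInv.join (t1 := s) (t2 := s) ?_ (DInv.empty G s) (DInv.empty G s)
    constructor <;> simp
  · rw [Finset.card_eq_one] at h
    obtain ⟨t, rfl⟩ := h
    have ht := hch t (by simp)
    refine DInv.join (t2 := s) ?_ (ih t (by simp)) (DInv.empty G s)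
    refine ⟨by simp, brD_not_mem, by simp, by simp, by simp, ?_, by simp⟩
    intro w hw
    exact brD_adj hG ht hw
  · rw [Finset.card_eq_two] at h
    obtain ⟨t, t', hne, rfl⟩ := h
    have ht := hch t (by simp)
    have ht' := hch t' (by simp)
    refine DInv.join ?_ (ih t (by simp)) (ih t' (by simp))
    refine ⟨by simp [Finset.biUnion_insert], brD_not_mem, brD_not_mem, ?_, ?_, ?_, ?_⟩
    · rw [Finset.disjoint_left]
      intro u hu hv
      exact (brD_disj hG ht ht' hne hu hv).1 rfl
    · intro u hu v hv
      exact (brD_disj hG ht ht' hne hu hv).2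
    · intro w hw
      exact brD_adj hG ht hw
    · intro w hw
      exact brD_adj hG ht' hw

theorem sub_deg (hsub : Subcubic G) (s : V) : (G.neighborFinset s).card ≤ 3 := by
  have := hsub s
  rwa [← SimpleGraph.coe_neighborFinset, Set.ncard_coe_finset] at this

theorem branch_inv (hG : G.IsAcyclic) (hsub : Subcubic G) : ∀ (n : ℕ) (p s : V), G.Adj p s →
    (brD G p s).card = n → DInv G (brD G p s) s := by
  intro n
  induction n using Nat.strong_induction_on with
  | _ n ih =>
    intro p s hp hn
    rw [brD_eq hG hp]
    refine node hG s _ ?_ ?_ ?_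
    · intro t ht
      simpa using (Finset.mem_erase.1 ht).2
    · have := sub_deg hsub s
      rw [Finset.card_erase_of_mem (by simpa using hp.symm)]
      omega
    · intro t ht
      rw [Finset.mem_erase, SimpleGraph.mem_neighborFinset] at ht
      refine ih _ ?_ s t ht.2 rfl
      rw [← hn]
      refine Finset.card_lt_card ⟨brD_sub hG hp ht.2 ht.1, fun h => ?_⟩
      exact brD_not_mem (h (brD_self hp.ne))

theorem tree_inv (hT : G.IsTree) (hsub : Subcubic G) : ∃ r, DInv G Finset.univ r := by
  have hG := hT.isAcyclic
  have hr : ∃ r, (G.neighborFinset r).card ≤ 2 := by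
    obtain ⟨v⟩ := hT.connected.nonempty
    rcases subsingleton_or_nontrivial V with h | h
    · refine ⟨v, ?_⟩
      have : G.neighborFinset v = ∅ := by
        ext w
        simp only [SimpleGraph.mem_neighborFinset, Finset.notMem_empty, iff_false]
        intro hw
        exact hw.ne (Subsingleton.elim _ _)
      simp [this]
    · obtain ⟨r, hr⟩ := hT.exists_vert_degree_one_of_nontrivial
      exact ⟨r, by rw [SimpleGraph.card_neighborFinset_eq_degree, hr]; norm_num⟩
  obtain ⟨r, hr⟩ := hr
  refine ⟨r, ?_⟩
  have e : (Finset.univ : Finset V) = {r} ∪ (G.neighborFinset r).biUnion (brD G r) := by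
    ext w
    simp only [Finset.mem_univ, Finset.mem_union, Finset.mem_singleton, Finset.mem_biUnion,
      SimpleGraph.mem_neighborFinset, true_iff]
    by_cases hw : w = r
    · exact Or.inl hw
    · obtain ⟨q⟩ := hT.connected.preconnected r w
      obtain ⟨t, h1, h2, h3⟩ := brD_cover hw q
      exact Or.inr ⟨t, h1, h3⟩
  rw [e]
  refine node hG r _ (fun t ht => by simpa using ht) hr ?_
  intro t ht
  exact branch_inv hG hsub _ r t (by simpa using ht) rfl

end TreePart

/-- If `T` is a subcubic tree of order `n` with dissociation number `ψ`, then the number of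
maximum dissociation sets of `T` is at most `1.466 ^ (4n - 5ψ + 2)`. -/
theorem numMaxDissoc_le_subcubic {V : Type*} [Fintype V] (T : SimpleGraph V)
    (hT : T.IsTree) (hsub : Subcubic T) :
    (numMaxDissoc T : ℝ) ≤
      (1.466 : ℝ) ^ ((4 * (Fintype.card V : ℤ) - 5 * (dissocNum T : ℤ) + 2)) := by
  obtain ⟨r, hr⟩ := tree_inv hT hsub
  exact final_bound hr
end

section
/- If T is a tree of order n and k is a positive integer, then the k-path vertex cover number of T is at most n/k. -/
/-- `S` is a `k`-path vertex cover of `G`: every path of order `k` in `G` contains a vertex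
of `S`. -/
def IsKPathVertexCover {V : Type*} (G : SimpleGraph V) (k : ℕ) (S : Finset V) : Prop :=
  ∀ (a b : V) (p : G.Walk a b), p.IsPath → p.length + 1 = k → ∃ x ∈ p.support, x ∈ S

/-- The `k`-path vertex cover number `τ_k(G)`. -/
noncomputable def kPathVertexCoverNum {V : Type*} [Fintype V] (G : SimpleGraph V) (k : ℕ) : ℕ :=
  sInf {n | ∃ S : Finset V, IsKPathVertexCover G k S ∧ S.card = n}

theorem aux_boundary {V : Type*} (G : SimpleGraph V) {a b : V} (p : G.Walk a b) (S : Set V)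
    {u w : V} (hu : u ∈ p.support) (hw : w ∈ p.support) (uS : u ∈ S) (wS : w ∉ S) :
    ∃ x ∈ p.support, ∃ y ∈ p.support, G.Adj x y ∧ x ∈ S ∧ y ∉ S := by
  classical
  by_cases ha : a ∈ S
  · obtain ⟨d, hd, h1, h2⟩ := (p.takeUntil w hw).exists_boundary_dart S ha wS
    exact ⟨d.fst, p.support_takeUntil_subset_support hw
        ((p.takeUntil w hw).dart_fst_mem_support_of_mem_darts hd), d.snd,
      p.support_takeUntil_subset_support hw
        ((p.takeUntil w hw).dart_snd_mem_support_of_mem_darts hd), d.adj, h1, h2⟩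
  · obtain ⟨d, hd, h1, h2⟩ := (p.takeUntil u hu).exists_boundary_dart Sᶜ ha (by simpa using uS)
    exact ⟨d.snd, p.support_takeUntil_subset_support hu
        ((p.takeUntil u hu).dart_snd_mem_support_of_mem_darts hd), d.fst,
      p.support_takeUntil_subset_support hu
        ((p.takeUntil u hu).dart_fst_mem_support_of_mem_darts hd), d.adj.symm,
        by simpa using h2, h1⟩

theorem aux_par {V : Type*} (T : SimpleGraph V) (hT : T.IsTree) :
    ∃ (r : V) (par : V → V) (d : V → ℕ), par r = r ∧ (∀ x, x ≠ r → d (par x) < d x) ∧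
      ∀ x y, T.Adj x y → y = par x ∨ x = par y := by
  classical
  obtain ⟨r⟩ := hT.connected.nonempty
  choose f hf hf' using (hT.existsUnique_path · r)
  refine ⟨r, fun x => (f x).snd, fun x => (f x).length, ?_, ?_, ?_⟩
  · show (f r).snd = r
    rw [← hf' r .nil .nil]
    simp
  · intro x hx
    show (f (f x).snd).length < (f x).length
    rw [← hf' _ (f x).tail (hf x).tail]
    have := SimpleGraph.Walk.length_tail_add_one (SimpleGraph.Walk.not_nil_of_ne hx (p := f x))
    omega
  · intro x y h
    show y = (f x).snd ∨ x = (f y).snd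
    by_cases hy : y ∈ (f x).support
    · exact Or.inl (hT.isAcyclic.eq_snd_of_adj_start (hf x) h hy)
    · right
      rw [← hf' _ (.cons h.symm (f x)) ((SimpleGraph.Walk.cons_isPath_iff _ _).2 ⟨hf _, hy⟩)]
      simp

theorem aux_leave {V : Type*} (T : SimpleGraph V) (par : V → V)
    (hadj : ∀ x y, T.Adj x y → y = par x ∨ x = par y) (v : V) {a b : V} (p : T.Walk a b)
    {u w : V} (hu : u ∈ p.support) (hw : w ∈ p.support)
    (uS : ∃ m : ℕ, par^[m] u = v) (wS : ¬ ∃ m : ℕ, par^[m] w = v) :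
    v ∈ p.support ∧ par v ∈ p.support := by
  obtain ⟨x, hx, y, hy, hxy, ⟨m, hm⟩, h2⟩ :=
    aux_boundary T p {z | ∃ m : ℕ, par^[m] z = v} hu hw uS wS
  rcases hadj x y hxy with h | h
  · cases m with
    | zero =>
      have hm : x = v := hm
      subst hm
      exact ⟨hx, h ▸ hy⟩
    | succ m =>
      exact absurd ⟨m, by rw [h, ← Function.iterate_succ_apply]; exact hm⟩ h2
  · exact absurd ⟨m + 1, by rw [Function.iterate_succ_apply, ← h]; exact hm⟩ h2

theorem aux_main {V : Type*} [Fintype V] (T : SimpleGraph V)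
    (hT : T.IsTree) (k : ℕ) (hk : 0 < k) : ∀ (n : ℕ) (A : Finset V), A.card = n →
    ∃ S : Finset V, k * S.card ≤ A.card ∧ ∀ (a b : V) (p : T.Walk a b), p.IsPath →
      p.length + 1 = k → (∀ x ∈ p.support, x ∈ A) → ∃ x ∈ p.support, x ∈ S := by
  classical
  obtain ⟨r, par, d, hr, hd, hadj⟩ := aux_par T hT
  have hroot : ∀ (n : ℕ) (x : V), d x = n → ∃ m : ℕ, par^[m] x = r := by
    intro n
    induction n using Nat.strong_induction_on with
    | _ n ih =>
      intro x hx
      by_cases h : x = r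
      · exact ⟨0, h⟩
      · obtain ⟨m, hm⟩ := ih (d (par x)) (hx ▸ hd x h) _ rfl
        exact ⟨m + 1, hm⟩
  intro n
  induction n using Nat.strong_induction_on with
  | _ n ih =>
    intro A hA
    let P : V → Prop := fun v => ∃ (a b : V) (p : T.Walk a b), p.IsPath ∧ p.length + 1 = k ∧
      (∀ x ∈ p.support, x ∈ A) ∧ ∀ x ∈ p.support, ∃ m : ℕ, par^[m] x = v
    by_cases hP : P r
    swap
    · refine ⟨∅, by simp, fun a b p h1 h2 h3 => ?_⟩
      exact absurd ⟨a, b, p, h1, h2, h3, fun x _ => hroot _ x rfl⟩ hP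
    obtain ⟨v, hv, hmax⟩ := Finset.exists_max_image (Finset.univ.filter P) d ⟨r, by simpa using hP⟩
    have hv : P v := by simpa using hv
    have hmax : ∀ c, P c → d c ≤ d v := fun c hc => hmax c (by simpa using hc)
    let D := A.filter fun x => ∃ m : ℕ, par^[m] x = v
    have hDc : k ≤ D.card := by
      obtain ⟨a, b, p, h1, h2, h3, h4⟩ := hv
      have : p.support.toFinset ⊆ D := by
        intro x hx
        have hx : x ∈ p.support := by simpa using hx
        exact Finset.mem_filter.2 ⟨h3 x hx, h4 x hx⟩
      have h5 := Finset.card_le_card this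
      rw [List.toFinset_card_of_nodup h1.support_nodup, SimpleGraph.Walk.length_support] at h5
      omega
    have hDA : D ⊆ A := Finset.filter_subset _ _
    have hcard := Finset.card_sdiff_add_card_eq_card hDA
    obtain ⟨S, hS1, hS2⟩ := ih (A \ D).card (by omega) (A \ D) rfl
    refine ⟨insert v S, ?_, ?_⟩
    · have := Finset.card_insert_le v S
      have := Nat.mul_le_mul_left k this
      rw [Nat.mul_add] at this
      omega
    intro a b p h1 h2 h3
    by_cases hD : ∃ x ∈ p.support, x ∈ D
    swap
    · obtain ⟨x, hx, hxS⟩ := hS2 a b p h1 h2 (fun x hx =>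
        Finset.mem_sdiff.2 ⟨h3 x hx, fun h => hD ⟨x, hx, h⟩⟩)
      exact ⟨x, hx, Finset.mem_insert_of_mem hxS⟩
    refine ⟨v, ?_, Finset.mem_insert_self _ _⟩
    obtain ⟨q, hq, hqD⟩ := hD
    have hqv : ∃ m : ℕ, par^[m] q = v := (Finset.mem_filter.1 hqD).2
    by_contra hvp
    have hm := Nat.find_spec hqv
    have hmin := fun j => Nat.find_min hqv (m := j)
    generalize Nat.find hqv = m at hm hmin
    cases m with
    | zero => exact hvp (by have hm : q = v := hm
                            exact hm ▸ hq)
    | succ m =>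
      have hcv : par (par^[m] q) = v := by rw [← Function.iterate_succ_apply' par]; exact hm
      have hne := hmin m (by omega)
      have hcr : par^[m] q ≠ r := by
        intro h
        apply hne
        rw [← hcv, h, hr]
      have hlt := hd _ hcr
      rw [hcv] at hlt
      have hnP : ¬ P (par^[m] q) := fun h => by have := hmax _ h; omega
      apply hnP
      refine ⟨a, b, p, h1, h2, h3, fun x hx => ?_⟩
      by_contra hxc
      have := (aux_leave T par hadj _ p hq hx ⟨m, rfl⟩ hxc).2
      rw [hcv] at this
      exact hvp this

/-- If `T` is a tree of order `n` and `k` is a positive integer, then `τ_k(T) ≤ n / k`. -/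
theorem kPathVertexCoverNum_le {V : Type*} [Fintype V] (T : SimpleGraph V)
    (hT : T.IsTree) (k : ℕ) (hk : 0 < k) :
    (kPathVertexCoverNum T k : ℝ) ≤ (Fintype.card V : ℝ) / k := by
  obtain ⟨S, hS1, hS2⟩ := aux_main T hT k hk _ Finset.univ rfl
  have h1 : kPathVertexCoverNum T k ≤ S.card :=
    Nat.sInf_le ⟨S, fun a b p h h' => hS2 a b p h h' (by simp), rfl⟩
  rw [le_div_iff₀ (by exact_mod_cast hk)]
  have h2 := Nat.mul_le_mul_left k h1
  rw [Finset.card_univ] at hS1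
  have h3 : kPathVertexCoverNum T k * k ≤ Fintype.card V := by
    rw [Nat.mul_comm]; exact h2.trans hS1
  exact_mod_cast h3
end
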